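/- Let k be a field, m ≤ n positive integers, and q any nonzero element of k. Then O_q(M_{m,n}(k)) is a quantum graded algebra with a straightening law on the poset (Δ_{m,n}, ≤st) of all quantum minors. -/

import Mathlib

/-- A *quantum graded algebra with a straightening law* over the field `k`, on the finite
poset `ι` (whose elements are realised in `A` via the map `elem`). -/
structure QuantumGradedASL (k : Type*) [Field k] (A : Type*) [Ring A] [Algebra k A]
    (𝒜 : ℕ → Submodule k A) (ι : Type*) [PartialOrder ι] [Finite ι] where
  /-- the map realising the elements of the poset `Π = ι` as elements of `A` -/
  elem : ι → A
  /-- `A` is an `ℕ`-graded `k`-algebra with grading `𝒜` -/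
  graded : GradedAlgebra 𝒜
  /-- (1) the elements of `Π` are homogeneous of positive degree -/
  homog : ∀ i : ι, ∃ d : ℕ, 0 < d ∧ elem i ∈ 𝒜 d
  /-- (2) the elements of `Π` generate `A` as a `k`-algebra -/
  gen : Algebra.adjoin k (Set.range elem) = ⊤
  /-- (3) the standard monomials (products of the `elem i` along nondecreasing lists,
  the empty product being `1`) form a linearly independent family -/
  indep : LinearIndependent k
    (fun l : {l : List ι // l.Chain' (· ≤ ·)} => ((l : List ι).map elem).prod)
  /-- (4) if `a`, `b` are incomparable then `elem a * elem b` is a linear combination of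
  terms `elem lam` or `elem lam * elem mu` with `lam ≤ mu`, `lam < a` and `lam < b` -/
  straighten : ∀ a b : ι, ¬ a ≤ b → ¬ b ≤ a →
    elem a * elem b ∈ Submodule.span k {x : A | ∃ lam : ι, lam < a ∧ lam < b ∧
      (x = elem lam ∨ ∃ mu : ι, lam ≤ mu ∧ x = elem lam * elem mu)}
  /-- (5) for all `a`, `b` there is `0 ≠ c ∈ k` such that `elem a * elem b - c • (elem b * elem a)`
  is a linear combination of terms `elem lam` or `elem lam * elem mu` with `lam ≤ mu`,
  `lam < a` and `lam < b` -/
  comm : ∀ a b : ι, ∃ c : k, c ≠ 0 ∧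
    elem a * elem b - c • (elem b * elem a) ∈
      Submodule.span k {x : A | ∃ lam : ι, lam < a ∧ lam < b ∧
        (x = elem lam ∨ ∃ mu : ι, lam ≤ mu ∧ x = elem lam * elem mu)}

/-- The defining relations of the algebra of quantum `m × n` matrices, with parameter the
unit `u`, imposed on the free algebra on the generators `X (i,j)`. -/
inductive qMatrixRel (R : Type*) [CommRing R] (u : Rˣ) (m n : ℕ) :
    FreeAlgebra R (Fin m × Fin n) → FreeAlgebra R (Fin m × Fin n) → Prop
  | row : ∀ (i : Fin m) (j l : Fin n), j < l →
      qMatrixRel R u m n (FreeAlgebra.ι R (i, j) * FreeAlgebra.ι R (i, l))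
        ((u : R) • (FreeAlgebra.ι R (i, l) * FreeAlgebra.ι R (i, j)))
  | col : ∀ (i k : Fin m) (j : Fin n), i < k →
      qMatrixRel R u m n (FreeAlgebra.ι R (i, j) * FreeAlgebra.ι R (k, j))
        ((u : R) • (FreeAlgebra.ι R (k, j) * FreeAlgebra.ι R (i, j)))
  | antidiag : ∀ (i k : Fin m) (j l : Fin n), k < i → j < l →
      qMatrixRel R u m n (FreeAlgebra.ι R (i, j) * FreeAlgebra.ι R (k, l))
        (FreeAlgebra.ι R (k, l) * FreeAlgebra.ι R (i, j))
  | diag : ∀ (i k : Fin m) (j l : Fin n), i < k → j < l →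
      qMatrixRel R u m n (FreeAlgebra.ι R (i, j) * FreeAlgebra.ι R (k, l))
        (FreeAlgebra.ι R (k, l) * FreeAlgebra.ι R (i, j) +
          ((u : R) - ((u⁻¹ : Rˣ) : R)) • (FreeAlgebra.ι R (i, l) * FreeAlgebra.ι R (k, j)))

/-- The algebra `O_u(M_{m,n}(R))` of quantum `m × n` matrices over `R`. -/
abbrev QuantumMat (R : Type*) [CommRing R] (u : Rˣ) (m n : ℕ) :=
  RingQuot (qMatrixRel R u m n)

/-- The generator `X i j` of the algebra of quantum matrices. -/
def qX (R : Type*) [CommRing R] (u : Rˣ) {m n : ℕ} (i : Fin m) (j : Fin n) :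
    QuantumMat R u m n :=
  RingQuot.mkAlgHom R (qMatrixRel R u m n) (FreeAlgebra.ι R (i, j))

/-- The number of inversions (i.e. the Coxeter length) of a permutation of `Fin t`. -/
def permLength {t : ℕ} (σ : Equiv.Perm (Fin t)) : ℕ :=
  (Finset.univ.filter fun p : Fin t × Fin t => p.1 < p.2 ∧ σ p.2 < σ p.1).card

/-- The index set `Π_{m,n}` of maximal quantum minors consists of the `m`-element subsets
`{j₁ < ⋯ < j_m} ⊆ {1,…,n}`, encoded as order embeddings `Fin m ↪o Fin n`; it carries the
standard partial order `I ≤st J ↔ ∀ s, i_s ≤ j_s` (pointwise order). -/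
instance piPartialOrder (m n : ℕ) : PartialOrder (Fin m ↪o Fin n) :=
  PartialOrder.lift (fun f => (f : Fin m → Fin n)) DFunLike.coe_injective

instance piFinite (m n : ℕ) : Finite (Fin m ↪o Fin n) :=
  Finite.of_injective (fun f => (f : Fin m → Fin n)) DFunLike.coe_injective

/-- The maximal quantum minor `[J] = Σ_{σ ∈ S_m} (−u)^{ℓ(σ)} X_{1 j_{σ(1)}} ⋯ X_{m j_{σ(m)}}`
of the generic matrix, for a column index set `J ∈ Π_{m,n}`. -/
def qMaximalMinor (R : Type*) [CommRing R] (u : Rˣ) {m n : ℕ} (J : Fin m ↪o Fin n) :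
    QuantumMat R u m n :=
  ∑ σ : Equiv.Perm (Fin m),
    ((-(u : R)) ^ permLength σ) • (List.ofFn fun i : Fin m => qX R u i (J (σ i))).prod


/-- An index pair `(I,J) ∈ Δ_{m,n}`: a pair of subsets `I ⊆ {1,…,m}`, `J ⊆ {1,…,n}` with
`|I| = |J| = t` for some `1 ≤ t ≤ m`, encoded by strictly increasing enumerations. -/
structure DeltaIdx (m n : ℕ) where
  /-- the common cardinality of the two index sets -/
  t : ℕ
  t_pos : 0 < t
  t_le : t ≤ m
  /-- the row index set `I = {i₁ < ⋯ < i_t}` -/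
  I : Fin t ↪o Fin m
  /-- the column index set `J = {j₁ < ⋯ < j_t}` -/
  J : Fin t ↪o Fin n

namespace DeltaIdx

/-- The standard partial order on `Δ_{m,n}`:  `(I,J) ≤st (K,L)` iff `|I| ≥ |K| = v`,
`i_s ≤ k_s` and `j_s ≤ l_s` for `1 ≤ s ≤ v`. -/
instance (m n : ℕ) : PartialOrder (DeltaIdx m n) where
  le P Q := ∃ h : Q.t ≤ P.t,
    (∀ s : Fin Q.t, P.I (Fin.castLE h s) ≤ Q.I s) ∧
    (∀ s : Fin Q.t, P.J (Fin.castLE h s) ≤ Q.J s)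
  le_refl P := ⟨le_rfl, fun s => le_of_eq (congrArg P.I (Fin.ext rfl)),
    fun s => le_of_eq (congrArg P.J (Fin.ext rfl))⟩
  le_trans P Q R := by
    rintro ⟨h1, hI1, hJ1⟩ ⟨h2, hI2, hJ2⟩
    refine ⟨h2.trans h1, fun s => ?_, fun s => ?_⟩
    · have e : Fin.castLE (h2.trans h1) s = Fin.castLE h1 (Fin.castLE h2 s) := Fin.ext rfl
      rw [e]
      exact (hI1 _).trans (hI2 s)
    · have e : Fin.castLE (h2.trans h1) s = Fin.castLE h1 (Fin.castLE h2 s) := Fin.ext rfl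
      rw [e]
      exact (hJ1 _).trans (hJ2 s)
  le_antisymm P Q := by
    rintro ⟨h1, hI1, hJ1⟩ ⟨h2, hI2, hJ2⟩
    obtain ⟨t, ht0, htm, I, J⟩ := P
    obtain ⟨t', ht0', htm', I', J'⟩ := Q
    dsimp only at h1 h2 hI1 hI2 hJ1 hJ2
    have ht : t = t' := le_antisymm h2 h1
    subst ht
    have eI : I = I' := by
      ext s
      have e : Fin.castLE h1 s = s := Fin.ext rfl
      have e2 : Fin.castLE h2 s = s := Fin.ext rfl
      exact congrArg Fin.val (le_antisymm (by simpa [e] using hI1 s) (by simpa [e2] using hI2 s))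
    have eJ : J = J' := by
      ext s
      have e : Fin.castLE h1 s = s := Fin.ext rfl
      have e2 : Fin.castLE h2 s = s := Fin.ext rfl
      exact congrArg Fin.val (le_antisymm (by simpa [e] using hJ1 s) (by simpa [e2] using hJ2 s))
    rw [eI, eJ]

/-- The padding map used to prove that `Δ_{m,n}` is finite. -/
def pad {m n : ℕ} (P : DeltaIdx m n) :
    (Fin m → WithTop (Fin m)) × (Fin m → WithTop (Fin n)) :=
  (fun s => if h : (s : ℕ) < P.t then (P.I ⟨s, h⟩ : WithTop (Fin m)) else ⊤,
   fun s => if h : (s : ℕ) < P.t then (P.J ⟨s, h⟩ : WithTop (Fin n)) else ⊤)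

lemma pad_injective {m n : ℕ} : Function.Injective (pad (m := m) (n := n)) := by
  intro P Q hPQ
  have h1 := congrArg Prod.fst hPQ
  have h2 := congrArg Prod.snd hPQ
  simp only [pad] at h1 h2
  have ht : P.t = Q.t := by
    by_contra hne
    rcases Nat.lt_or_ge P.t Q.t with h | h
    · have hfun := congrFun h1 ⟨P.t, lt_of_lt_of_le h Q.t_le⟩
      rw [dif_neg (by simp), dif_pos (by simpa using h)] at hfun
      exact (WithTop.coe_ne_top (hfun.symm)).elim
    · rcases Nat.lt_or_ge Q.t P.t with h' | h'
      · have hfun := congrFun h1 ⟨Q.t, lt_of_lt_of_le h' P.t_le⟩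
        rw [dif_pos (by simpa using h'), dif_neg (by simp)] at hfun
        exact (WithTop.coe_ne_top hfun).elim
      · exact hne (le_antisymm h' h)
  obtain ⟨t, ht0, htm, I, J⟩ := P
  obtain ⟨t', ht0', htm', I', J'⟩ := Q
  dsimp only at ht h1 h2
  subst ht
  have eI : I = I' := by
    ext s
    have hfun := congrFun h1 ⟨(s : ℕ), lt_of_lt_of_le s.isLt htm⟩
    rw [dif_pos (by simp), dif_pos (by simp)] at hfun
    have : I ⟨(s : ℕ), s.isLt⟩ = I' ⟨(s : ℕ), s.isLt⟩ := by
      exact_mod_cast hfun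
    simpa using congrArg Fin.val this
  have eJ : J = J' := by
    ext s
    have hfun := congrFun h2 ⟨(s : ℕ), lt_of_lt_of_le s.isLt htm⟩
    rw [dif_pos (by simp), dif_pos (by simp)] at hfun
    have : J ⟨(s : ℕ), s.isLt⟩ = J' ⟨(s : ℕ), s.isLt⟩ := by
      exact_mod_cast hfun
    simpa using congrArg Fin.val this
  rw [eI, eJ]

instance (m n : ℕ) : Finite (DeltaIdx m n) := by
  have : Finite (WithTop (Fin m)) := inferInstanceAs (Finite (Option (Fin m)))
  have : Finite (WithTop (Fin n)) := inferInstanceAs (Finite (Option (Fin n)))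
  exact Finite.of_injective pad pad_injective

end DeltaIdx

/-- The `t × t` quantum minor `[I|J] = Σ_{σ ∈ S_t} (−u)^{ℓ(σ)} X_{i₁ j_{σ(1)}} ⋯ X_{i_t j_{σ(t)}}`
of the generic matrix, for an index pair `(I,J) ∈ Δ_{m,n}`. -/
def qMinor (R : Type*) [CommRing R] (u : Rˣ) {m n : ℕ} (P : DeltaIdx m n) :
    QuantumMat R u m n :=
  ∑ σ : Equiv.Perm (Fin P.t),
    ((-(u : R)) ^ permLength σ) •
      (List.ofFn fun s : Fin P.t => qX R u (P.I s) (P.J (σ s))).prod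

section QExterior

variable {k : Type*} [Field k] {ι : Type*} [LinearOrder ι]

/-- The number of pairs `(a, b) ∈ A × B` with `b < a`. -/
def crossings (A B : Finset ι) : ℕ := ∑ a ∈ A, ∑ b ∈ B, if b < a then 1 else 0

lemma crossings_empty_left (B : Finset ι) : crossings ∅ B = 0 := by simp [crossings]

lemma crossings_empty_right (A : Finset ι) : crossings A ∅ = 0 := by simp [crossings]

lemma crossings_union_left {A A' : Finset ι} (h : Disjoint A A') (B : Finset ι) :
    crossings (A ∪ A') B = crossings A B + crossings A' B := Finset.sum_union h

lemma crossings_union_right (A : Finset ι) {B B' : Finset ι} (h : Disjoint B B') :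
    crossings A (B ∪ B') = crossings A B + crossings A B' := by
  simp only [crossings, Finset.sum_union h, Finset.sum_add_distrib]

lemma crossings_insert_left {a : ι} {A : Finset ι} (h : a ∉ A) (B : Finset ι) :
    crossings (insert a A) B = crossings {a} B + crossings A B := by
  simp [crossings, Finset.sum_insert h]

lemma crossings_insert_right (A : Finset ι) {b : ι} {B : Finset ι} (h : b ∉ B) :
    crossings A (insert b B) = crossings A {b} + crossings A B := by
  rw [Finset.insert_eq, crossings_union_right _ (Finset.disjoint_singleton_left.2 h)]

lemma crossings_singleton_of_lt {a : ι} {B : Finset ι} (h : ∀ b ∈ B, a < b) :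
    crossings {a} B = 0 := by
  simp only [crossings, Finset.sum_singleton]
  exact Finset.sum_eq_zero fun b hb => if_neg (h b hb).not_gt

lemma crossings_singleton_singleton {a b : ι} (h : b < a) :
    crossings ({a} : Finset ι) {b} = 1 := by
  simp only [crossings, Finset.sum_singleton, if_pos h]

lemma crossings_singleton_singleton_of_lt {a b : ι} (h : a < b) :
    crossings ({a} : Finset ι) {b} = 0 := by
  simp only [crossings, Finset.sum_singleton, if_neg h.not_gt]

/-- A family of elements satisfying the relations of a quantum exterior algebra. -/
structure IsQExterior {R : Type*} [Ring R] [Algebra k R] (z : k) (r : ι → R) : Prop where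
  sq : ∀ i, r i * r i = 0
  swap : ∀ i j, i < j → r j * r i = z • (r i * r j)

/-- The product of a family over a finite set, taken in increasing order. -/
def orderedProd {R : Type*} [Ring R] (r : ι → R) (S : Finset ι) : R := (S.sort.map r).prod

lemma orderedProd_empty {R : Type*} [Ring R] (r : ι → R) : orderedProd r ∅ = 1 := by
  simp [orderedProd]

lemma orderedProd_insert {R : Type*} [Ring R] (r : ι → R) {a : ι} {S : Finset ι}
    (h : ∀ b ∈ S, a < b) : orderedProd r (insert a S) = r a * orderedProd r S := by
  rw [orderedProd, Finset.sort_insert _ (fun b hb => (h b hb).le) (fun ha => (h a ha).false)]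
  simp [orderedProd]

variable {R : Type*} [Ring R] [Algebra k R] {z : k} {r : ι → R}

lemma IsQExterior.mul_orderedProd (hr : IsQExterior z r) (a : ι) (T : Finset ι) :
    r a * orderedProd r T =
      if a ∈ T then 0 else z ^ crossings {a} T • orderedProd r (insert a T) := by
  induction T using Finset.induction_on_min with
  | empty => simp [crossings_empty_right, orderedProd]
  | insert t T ht ih =>
    rw [orderedProd_insert r ht]
    rcases lt_trichotomy a t with h | h | h
    · have hlt : ∀ b ∈ insert t T, a < b := by
        simp only [Finset.mem_insert, forall_eq_or_imp]
        exact ⟨h, fun b hb => h.trans (ht b hb)⟩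
      rw [if_neg fun ha => (hlt a ha).false, crossings_singleton_of_lt hlt,
        orderedProd_insert r hlt, orderedProd_insert r ht, pow_zero, one_smul]
    · subst h
      simp [← mul_assoc, hr.sq]
    · rw [← mul_assoc, hr.swap t a h, smul_mul_assoc, mul_assoc, ih]
      by_cases ha : a ∈ T
      · simp [ha]
      · have htT : t ∉ T := fun h' => (ht t h').false
        rw [if_neg ha, if_neg (by simp [ha, h.ne']), crossings_insert_right _ htT,
          crossings_singleton_singleton h, Finset.insert_comm a t T, orderedProd_insert r (a := t),
          mul_smul_comm, smul_smul, pow_add, pow_one]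
        simp only [Finset.mem_insert, forall_eq_or_imp]
        exact ⟨h, ht⟩

lemma IsQExterior.orderedProd_mul (hr : IsQExterior z r) (S Q : Finset ι) :
    orderedProd r S * orderedProd r Q =
      if Disjoint S Q then z ^ crossings S Q • orderedProd r (S ∪ Q) else 0 := by
  induction S using Finset.induction_on_min with
  | empty => simp [crossings_empty_left, orderedProd_empty]
  | insert a S ha ih =>
    have haS : a ∉ S := fun h => (ha a h).false
    rw [orderedProd_insert r ha, mul_assoc, ih]
    by_cases hd : Disjoint S Q
    · rw [if_pos hd, mul_smul_comm, hr.mul_orderedProd]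
      by_cases haQ : a ∈ Q
      · simp [haQ]
      · rw [if_neg (by simp [haS, haQ]), if_pos (by simp [haQ, hd]), smul_smul, ← pow_add,
          Finset.insert_union, crossings_insert_left haS, crossings_union_right _ hd,
          crossings_singleton_of_lt ha, zero_add, add_comm]
    · rw [if_neg hd, if_neg (by simp [hd]), mul_zero]

end QExterior

section QMatrix

/-- A matrix with entries in a `k`-algebra which satisfies the relations of quantum matrices. -/
structure IsQMatrix {k : Type*} [Field k] {ι κ : Type*} [LinearOrder ι] [LinearOrder κ]
    {B : Type*} [Semiring B] [Algebra k B] (q : k) (X : ι → κ → B) : Prop where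
  row : ∀ i j l, j < l → X i j * X i l = q • (X i l * X i j)
  col : ∀ i h j, i < h → X i j * X h j = q • (X h j * X i j)
  antidiag : ∀ i h j l, i < h → j < l → X h j * X i l = X i l * X h j
  diag : ∀ i h j l, i < h → j < l →
    X i j * X h l = X h l * X i j + (q - q⁻¹) • (X i l * X h j)

variable {k : Type*} [Field k] {ι κ ν : Type*} [LinearOrder ι] [LinearOrder κ] [LinearOrder ν]
  {B : Type*} [Ring B] [Algebra k B] {q : k} {X : ι → κ → B}

/-- The transpose of a quantum matrix is a quantum matrix. -/
lemma IsQMatrix.transpose {B : Type*} [Semiring B] [Algebra k B] {X : ι → κ → B}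
    (hX : IsQMatrix q X) : IsQMatrix q fun j i => X i j where
  row i j l h := hX.col j l i h
  col i h j hi := hX.row j i h hi
  antidiag i h j l hi hj := (hX.antidiag j l i h hj hi).symm
  diag i h j l hi hj := by rw [hX.diag j l i h hj hi, hX.antidiag j l i h hj hi]

lemma IsQMatrix.submatrix {B : Type*} [Semiring B] [Algebra k B] {X : ι → κ → B}
    (hX : IsQMatrix q X) {ι' κ' : Type*} [LinearOrder ι'] [LinearOrder κ']
    {f : ι' → ι} {g : κ' → κ} (hf : StrictMono f) (hg : StrictMono g) :
    IsQMatrix q fun i j => X (f i) (g j) where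
  row _ _ _ h := hX.row _ _ _ (hg h)
  col _ _ _ hi := hX.col _ _ _ (hf hi)
  antidiag _ _ _ _ hi hj := hX.antidiag _ _ _ _ (hf hi) (hg hj)
  diag _ _ _ _ hi hj := hX.diag _ _ _ _ (hf hi) (hg hj)

/-- Left multiplication by `∑ j, X i j ⊗ e j` on `B ⊗ Λ`, where `Λ` is the quantum exterior
algebra, whose elements are written as functions on finite sets of column indices. -/
def rowOp (q : k) (X : ι → κ → B) (i : ι) : Module.End k (Finset κ → B) where
  toFun f J := ∑ j ∈ J, (-q) ^ crossings {j} (J.erase j) • (X i j * f (J.erase j))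
  map_add' f g := by
    ext J
    simp [mul_add, Finset.sum_add_distrib]
  map_smul' c f := by
    ext J
    simp only [Pi.smul_apply, mul_smul_comm, RingHom.id_apply, Finset.smul_sum]
    exact Finset.sum_congr rfl fun j _ => smul_comm _ _ _

lemma rowOp_apply (q : k) (X : ι → κ → B) (i : ι) (f : Finset κ → B) (J : Finset κ) :
    rowOp q X i f J =
      ∑ j ∈ J, (-q) ^ crossings {j} (J.erase j) • (X i j * f (J.erase j)) := rfl

/-- The quantum minor with row set `I` and column set `J`; it vanishes if `I` and `J` do not have
the same cardinality. -/
def minor (q : k) (X : ι → κ → B) (I : Finset ι) (J : Finset κ) : B :=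
  orderedProd (rowOp q X) I (Pi.single ∅ 1) J

lemma Finset.sum_powerset_sum_erase {M : Type*} [AddCommMonoid M] (L : Finset κ)
    (F : κ → Finset κ → M) :
    ∑ S ∈ L.powerset, ∑ j ∈ S, F j (S.erase j) =
      ∑ j ∈ L, ∑ S ∈ (L.erase j).powerset, F j S := by
  rw [Finset.sum_sigma', Finset.sum_sigma']
  refine Finset.sum_bij' (fun x _ => ⟨x.2, x.1.erase x.2⟩) (fun x _ => ⟨insert x.1 x.2, x.1⟩)
    ?_ ?_ ?_ ?_ ?_
  · rintro ⟨S, j⟩ h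
    simp only [Finset.mem_sigma, Finset.mem_powerset] at h ⊢
    exact ⟨h.1 h.2, Finset.erase_subset_erase _ h.1⟩
  · rintro ⟨j, S⟩ h
    simp only [Finset.mem_sigma, Finset.mem_powerset] at h ⊢
    exact ⟨Finset.insert_subset h.1 (h.2.trans (Finset.erase_subset _ _)),
      Finset.mem_insert_self _ _⟩
  · rintro ⟨S, j⟩ h
    simp only [Finset.mem_sigma, Finset.mem_powerset] at h ⊢
    simp [Finset.insert_erase h.2]
  · rintro ⟨j, S⟩ h
    simp only [Finset.mem_sigma, Finset.mem_powerset] at h ⊢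
    have : j ∉ S := fun hj => by simpa using h.2 hj
    simp [Finset.erase_insert this]
  · intros
    rfl

lemma Finset.sum_sum_erase_eq_sum_pairs {M : Type*} [AddCommMonoid M] (J : Finset κ)
    (F : κ → κ → M) :
    ∑ j ∈ J, ∑ l ∈ J.erase j, F j l = ∑ j ∈ J, ∑ l ∈ J with j < l, (F j l + F l j) := by
  have h : ∀ j ∈ J, ∑ l ∈ J.erase j, F j l =
      (∑ l ∈ J, if j < l then F j l else 0) + ∑ l ∈ J, if l < j then F j l else 0 := by
    intro j hj
    rw [← Finset.sum_add_distrib, ← Finset.sum_erase (s := J) (a := j)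
      (f := fun l => (if j < l then F j l else 0) + if l < j then F j l else 0)]
    · refine Finset.sum_congr rfl fun l hl => ?_
      rcases lt_or_gt_of_ne (Finset.ne_of_mem_erase hl) with h | h <;> simp [h, h.not_gt]
    · simp
  rw [Finset.sum_congr rfl h, Finset.sum_add_distrib,
    Finset.sum_comm (f := fun j l => if l < j then F j l else 0), ← Finset.sum_add_distrib]
  simp only [Finset.sum_filter, ← Finset.sum_add_distrib]
  refine Finset.sum_congr rfl fun j _ => Finset.sum_congr rfl fun l _ => ?_
  split_ifs <;> simp

lemma crossings_erase_erase_of_lt {J : Finset κ} {j l : κ} (hl : l ∈ J) (h : j < l) :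
    crossings {j} (J.erase j) = crossings {j} ((J.erase j).erase l) := by
  conv_lhs => rw [← Finset.insert_erase (Finset.mem_erase.2 ⟨h.ne', hl⟩)]
  rw [crossings_insert_right _ (Finset.notMem_erase _ _), crossings_singleton_singleton_of_lt h,
    zero_add]

lemma crossings_erase_erase_of_gt {J : Finset κ} {j l : κ} (hj : j ∈ J) (h : j < l) :
    crossings {l} (J.erase l) = 1 + crossings {l} ((J.erase j).erase l) := by
  rw [Finset.erase_right_comm]
  conv_lhs => rw [← Finset.insert_erase (Finset.mem_erase.2 ⟨h.ne, hj⟩)]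
  rw [crossings_insert_right _ (Finset.notMem_erase _ _), crossings_singleton_singleton h]

lemma rowOp_mul_rowOp_apply (q : k) (X : ι → κ → B) (h i : ι) (f : Finset κ → B)
    (J : Finset κ) :
    (rowOp q X h * rowOp q X i) f J = ∑ j ∈ J, ∑ l ∈ J with j < l,
      (-q) ^ (crossings {j} ((J.erase j).erase l) + crossings {l} ((J.erase j).erase l)) •
        ((X h j * X i l - q • (X h l * X i j)) * f ((J.erase j).erase l)) := by
  rw [Module.End.mul_apply, rowOp_apply]
  simp only [rowOp_apply, Finset.mul_sum, Finset.smul_sum]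
  rw [Finset.sum_sum_erase_eq_sum_pairs]
  refine Finset.sum_congr rfl fun j hj => Finset.sum_congr rfl fun l hl => ?_
  rw [Finset.mem_filter] at hl
  rw [crossings_erase_erase_of_lt hl.1 hl.2, crossings_erase_erase_of_gt hj hl.2,
    Finset.erase_right_comm (a := l)]
  simp only [mul_smul_comm, smul_smul, ← pow_add, sub_mul, smul_sub, smul_mul_assoc, mul_assoc]
  rw [sub_eq_add_neg, ← neg_smul]
  congr 2
  rw [add_comm (crossings {j} _), ← mul_neg, ← pow_succ]
  congr 1
  ring

lemma IsQMatrix.cross (hq : q ≠ 0) (hX : IsQMatrix q X) {i h : ι} {j l : κ} (hi : i < h)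
    (hj : j < l) :
    X h j * X i l - q • (X h l * X i j) = (-q) • (X i j * X h l - q • (X i l * X h j)) := by
  rw [hX.antidiag _ _ _ _ hi hj, hX.diag _ _ _ _ hi hj]
  match_scalars <;> field_simp <;> ring

lemma rowOp_isQExterior (hq : q ≠ 0) (hX : IsQMatrix q X) : IsQExterior (-q) (rowOp q X) where
  sq i := by
    refine LinearMap.ext fun f => funext fun J => ?_
    rw [rowOp_mul_rowOp_apply]
    refine Finset.sum_eq_zero fun j _ => Finset.sum_eq_zero fun l hl => ?_
    rw [hX.row _ _ _ (Finset.mem_filter.1 hl).2, sub_self, zero_mul, smul_zero]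
  swap i h hi := by
    refine LinearMap.ext fun f => funext fun J => ?_
    rw [LinearMap.smul_apply, Pi.smul_apply, rowOp_mul_rowOp_apply, rowOp_mul_rowOp_apply]
    simp only [Finset.smul_sum]
    refine Finset.sum_congr rfl fun j _ => Finset.sum_congr rfl fun l hl => ?_
    rw [hX.cross hq hi (Finset.mem_filter.1 hl).2, smul_mul_assoc, smul_comm]

end QMatrix

section Minors

variable {k : Type*} [Field k] {ι κ ν : Type*} [LinearOrder ι] [LinearOrder κ] [LinearOrder ν]
  {B : Type*} [Ring B] [Algebra k B] {q : k} {X : ι → κ → B}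

lemma minor_empty_left (q : k) (X : ι → κ → B) (J : Finset κ) :
    minor q X ∅ J = if J = ∅ then 1 else 0 := by
  simp [minor, orderedProd_empty, Pi.single_apply]

lemma minor_insert_left (q : k) (X : ι → κ → B) {i : ι} {I : Finset ι} (h : ∀ b ∈ I, i < b)
    (J : Finset κ) :
    minor q X (insert i I) J =
      ∑ j ∈ J, (-q) ^ crossings {j} (J.erase j) • (X i j * minor q X I (J.erase j)) := by
  rw [minor, orderedProd_insert _ h, Module.End.mul_apply, rowOp_apply]
  rfl

lemma minor_eq_zero_of_card_ne (q : k) (X : ι → κ → B) {I : Finset ι} {J : Finset κ}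
    (h : I.card ≠ J.card) : minor q X I J = 0 := by
  induction I using Finset.induction_on_min generalizing J with
  | empty =>
    rw [minor_empty_left, if_neg]
    rintro rfl
    exact h rfl
  | insert i I hi ih =>
    rw [minor_insert_left q X hi]
    refine Finset.sum_eq_zero fun j hj => ?_
    rw [ih, mul_zero, smul_zero]
    rw [Finset.card_insert_of_notMem fun h => (hi i h).false] at h
    have := Finset.card_erase_add_one hj
    omega

lemma minor_empty_right (q : k) (X : ι → κ → B) (I : Finset ι) :
    minor q X I ∅ = if I = ∅ then 1 else 0 := by
  by_cases h : I = ∅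
  · subst h
    simp [minor_empty_left]
  · rw [if_neg h, minor_eq_zero_of_card_ne]
    simpa using h

lemma minor_singleton (q : k) (X : ι → κ → B) (i : ι) (j : κ) :
    minor q X {i} {j} = X i j := by
  rw [← insert_empty_eq, minor_insert_left q X (by simp)]
  simp [minor_empty_left, crossings_empty_right]

lemma orderedProd_rowOp_apply (q : k) (X : ι → κ → B) (S : Finset ι) (f : Finset κ → B)
    (L : Finset κ) :
    orderedProd (rowOp q X) S f L =
      ∑ L₁ ∈ L.powerset, (-q) ^ crossings L₁ (L \ L₁) • (minor q X S L₁ * f (L \ L₁)) := by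
  induction S using Finset.induction_on_min generalizing L with
  | empty =>
    rw [Finset.sum_eq_single ∅]
    · simp [orderedProd_empty, crossings_empty_left, minor_empty_left]
    · intro L₁ _ h
      simp [minor_empty_left, h]
    · simp
  | insert a S ha ih =>
    have key : ∀ L₁ ∈ L.powerset,
        (-q) ^ crossings L₁ (L \ L₁) • (minor q X (insert a S) L₁ * f (L \ L₁)) =
        ∑ j ∈ L₁, (-q) ^ (crossings (insert j (L₁.erase j)) (L \ insert j (L₁.erase j)) +
          crossings {j} (L₁.erase j)) • (X a j * (minor q X S (L₁.erase j) *
            f (L \ insert j (L₁.erase j)))) := by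
      intro L₁ _
      rw [minor_insert_left q X ha, Finset.sum_mul, Finset.smul_sum]
      refine Finset.sum_congr rfl fun j hj => ?_
      rw [Finset.insert_erase hj, pow_add, smul_mul_assoc, smul_smul, mul_assoc]
    rw [Finset.sum_congr rfl key, Finset.sum_powerset_sum_erase L fun j S' =>
      (-q) ^ (crossings (insert j S') (L \ insert j S') + crossings {j} S') •
        (X a j * (minor q X S S' * f (L \ insert j S')))]
    rw [orderedProd_insert _ ha, Module.End.mul_apply, rowOp_apply]
    refine Finset.sum_congr rfl fun j hj => ?_
    rw [ih, Finset.mul_sum, Finset.smul_sum]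
    refine Finset.sum_congr rfl fun L₁ hL₁ => ?_
    rw [Finset.mem_powerset] at hL₁
    have hjL : j ∉ L₁ := fun h => Finset.notMem_erase _ _ (hL₁ h)
    have e : L.erase j \ L₁ = L \ insert j L₁ := by
      ext x
      simp only [Finset.mem_sdiff, Finset.mem_erase, Finset.mem_insert]
      tauto
    rw [mul_smul_comm, smul_smul, ← pow_add]
    congr 2
    · conv_lhs => rw [← Finset.union_sdiff_of_subset hL₁]
      rw [crossings_union_right _ Finset.disjoint_sdiff, Finset.union_sdiff_of_subset hL₁,
        crossings_insert_left hjL, e]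
      ring
    · rw [e]

/-- Laplace expansion along rows. -/
lemma sum_minor_mul_minor (hq : q ≠ 0) (hX : IsQMatrix q X) (S Q : Finset ι) (L : Finset κ) :
    ∑ L₁ ∈ L.powerset, (-q) ^ crossings L₁ (L \ L₁) • (minor q X S L₁ * minor q X Q (L \ L₁)) =
      if Disjoint S Q then (-q) ^ crossings S Q • minor q X (S ∪ Q) L else 0 := by
  have h := congrFun (LinearMap.congr_fun ((rowOp_isQExterior hq hX).orderedProd_mul S Q)
    (Pi.single ∅ 1)) L
  rw [Module.End.mul_apply, orderedProd_rowOp_apply] at h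
  refine h.trans ?_
  split_ifs
  · rfl
  · rfl

lemma minor_transpose (hX : IsQMatrix q X) (I : Finset ι) (J : Finset κ) :
    minor q (fun j i => X i j) J I = minor q X I J := by
  induction hn : I.card using Nat.strong_induction_on generalizing I J with
  | _ n ih =>
  subst hn
  rcases I.eq_empty_or_nonempty with rfl | hI
  · rw [minor_empty_left, minor_empty_right]
  rcases J.eq_empty_or_nonempty with rfl | hJ
  · rw [minor_empty_left, minor_empty_right]
  obtain ⟨i, I, hi, rfl⟩ : ∃ i, ∃ I' : Finset ι, (∀ b ∈ I', i < b) ∧ I = insert i I' :=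
    ⟨I.min' hI, I.erase (I.min' hI), fun b hb => Finset.min'_lt_of_mem_erase_min' _ _ hb,
      (Finset.insert_erase (Finset.min'_mem _ _)).symm⟩
  obtain ⟨j, J, hj, rfl⟩ : ∃ j, ∃ J' : Finset κ, (∀ b ∈ J', j < b) ∧ J = insert j J' :=
    ⟨J.min' hJ, J.erase (J.min' hJ), fun b hb => Finset.min'_lt_of_mem_erase_min' _ _ hb,
      (Finset.insert_erase (Finset.min'_mem _ _)).symm⟩
  have hiI : i ∉ I := fun h => (hi i h).false
  have hjJ : j ∉ J := fun h => (hj j h).false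
  have hcI := Finset.card_insert_of_notMem hiI
  rw [minor_insert_left _ _ hi, minor_insert_left _ _ hj, Finset.sum_insert hiI,
    Finset.sum_insert hjJ, Finset.erase_insert hiI, Finset.erase_insert hjJ,
    crossings_singleton_of_lt hi, crossings_singleton_of_lt hj, ih I.card (by omega) I J rfl]
  congr 1
  have e1 : ∀ h ∈ I, (insert i I).erase h = insert i (I.erase h) := fun h hh =>
    Finset.erase_insert_of_ne (hi h hh).ne
  have e2 : ∀ l ∈ J, (insert j J).erase l = insert j (J.erase l) := fun h hh =>
    Finset.erase_insert_of_ne (hj h hh).ne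
  have hcr : ∀ h ∈ I, crossings {h} (insert i (I.erase h)) = 1 + crossings {h} (I.erase h) := by
    intro h hh
    rw [crossings_insert_right _ (fun h' => hiI (Finset.mem_of_mem_erase h')),
      crossings_singleton_singleton (hi h hh)]
  have hcr' : ∀ h ∈ J, crossings {h} (insert j (J.erase h)) = 1 + crossings {h} (J.erase h) := by
    intro h hh
    rw [crossings_insert_right _ (fun h' => hjJ (Finset.mem_of_mem_erase h')),
      crossings_singleton_singleton (hj h hh)]
  have hl : ∀ h ∈ I, (-q) ^ crossings {h} ((insert i I).erase h) •
      (X h j * minor q (fun j i => X i j) J ((insert i I).erase h)) =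
      ∑ l ∈ J, (-q) ^ (1 + crossings {h} (I.erase h) + crossings {l} (J.erase l)) •
        (X i l * X h j * minor q X (I.erase h) (J.erase l)) := by
    intro h hh
    have hc := Finset.card_erase_lt_of_mem hh
    rw [e1 h hh, ih (insert i (I.erase h)).card _ _ _ rfl, minor_insert_left _ _
      (fun b hb => hi b (Finset.mem_of_mem_erase hb)), hcr h hh, Finset.mul_sum, Finset.smul_sum]
    · refine Finset.sum_congr rfl fun l hl => ?_
      rw [mul_smul_comm, smul_smul, ← pow_add, ← mul_assoc,
        hX.antidiag i h j l (hi h hh) (hj l hl)]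
    · rw [Finset.card_insert_of_notMem (fun h' => hiI (Finset.mem_of_mem_erase h'))]
      omega
  have hr : ∀ l ∈ J, (-q) ^ crossings {l} ((insert j J).erase l) •
      (X i l * minor q X I ((insert j J).erase l)) =
      ∑ h ∈ I, (-q) ^ (1 + crossings {h} (I.erase h) + crossings {l} (J.erase l)) •
        (X i l * X h j * minor q X (I.erase h) (J.erase l)) := by
    intro l hl
    rw [e2 l hl, ← ih I.card (by omega) _ _ rfl, minor_insert_left _ _
      (fun b hb => hj b (Finset.mem_of_mem_erase hb)), hcr' l hl, Finset.mul_sum, Finset.smul_sum]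
    refine Finset.sum_congr rfl fun h hh => ?_
    have hc := Finset.card_erase_lt_of_mem hh
    rw [mul_smul_comm, smul_smul, ← pow_add, ← mul_assoc, ih _ (by omega) _ _ rfl]
    congr 2
    ring
  rw [Finset.sum_congr rfl hl, Finset.sum_congr rfl hr, Finset.sum_comm]

/-- Laplace expansion along columns. -/
lemma sum_minor_mul_minor' (hq : q ≠ 0) (hX : IsQMatrix q X) (P : Finset ι) (J L : Finset κ) :
    ∑ S ∈ P.powerset, (-q) ^ crossings S (P \ S) • (minor q X S J * minor q X (P \ S) L) =
      if Disjoint J L then (-q) ^ crossings J L • minor q X P (J ∪ L) else 0 := by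
  simpa only [minor_transpose hX] using sum_minor_mul_minor hq hX.transpose J L P

lemma Commute.minor_right {b : B} (I : Finset ι) (J : Finset κ)
    (h : ∀ i j, Commute b (X i j)) : Commute b (minor q X I J) := by
  induction I using Finset.induction_on_min generalizing J with
  | empty =>
    rw [minor_empty_left]
    split_ifs
    exacts [Commute.one_right _, Commute.zero_right _]
  | insert i I hi ih =>
    rw [minor_insert_left q X hi]
    exact Commute.sum_right _ _ _ fun j _ => ((h i j).mul_right (ih _)).smul_right _

/-- The Cauchy-Binet formula. -/
lemma minor_mul [Fintype ν] (hq : q ≠ 0) {N : ι → ν → B} {Y : ν → κ → B}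
    (hY : IsQMatrix q Y) (h : ∀ i a b j, Commute (Y b j) (N i a)) (I : Finset ι) (J : Finset κ) :
    minor q (fun i j => ∑ a, N i a * Y a j) I J =
      ∑ K : Finset ν, minor q N I K * minor q Y K J := by
  induction I using Finset.induction_on_min generalizing J with
  | empty =>
    rw [Finset.sum_eq_single ∅]
    · simp [minor_empty_left]
    · intro K _ hK
      simp [minor_empty_left, hK]
    · simp
  | insert i I hi ih =>
    have hR : ∀ K ∈ (Finset.univ : Finset (Finset ν)),
        minor q N (insert i I) K * minor q Y K J =
        ∑ a ∈ K, (-q) ^ crossings {a} (K.erase a) • (N i a * (minor q N I (K.erase a) *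
          minor q Y (insert a (K.erase a)) J)) := by
      intro K _
      rw [minor_insert_left q N hi, Finset.sum_mul]
      refine Finset.sum_congr rfl fun a ha => ?_
      rw [Finset.insert_erase ha, smul_mul_assoc, mul_assoc]
    rw [Finset.sum_congr rfl hR, ← Finset.powerset_univ, Finset.sum_powerset_sum_erase _
      fun a K => (-q) ^ crossings {a} K • (N i a * (minor q N I K *
          minor q Y (insert a K) J))]
    have hL : ∀ j ∈ J, (-q) ^ crossings {j} (J.erase j) • ((∑ a, N i a * Y a j) *
        minor q (fun i j => ∑ a, N i a * Y a j) I (J.erase j)) =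
        ∑ a, ∑ K : Finset ν, N i a * (minor q N I K *
          ((-q) ^ crossings {j} (J.erase j) • (Y a j * minor q Y K (J.erase j)))) := by
      intro j _
      rw [ih, Finset.sum_mul, Finset.smul_sum]
      refine Finset.sum_congr rfl fun a _ => ?_
      rw [Finset.mul_sum, Finset.smul_sum]
      refine Finset.sum_congr rfl fun K _ => ?_
      rw [mul_smul_comm, mul_smul_comm, ← mul_assoc (minor q N I K),
        ← (Commute.minor_right I K fun i' b => h i' b a j).eq]
      simp only [mul_assoc]
    rw [minor_insert_left _ _ hi, Finset.sum_congr rfl hL, Finset.sum_comm]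
    refine Finset.sum_congr rfl fun a _ => ?_
    rw [Finset.sum_comm]
    have hK : ∀ K : Finset ν, ∑ j ∈ J, N i a * (minor q N I K *
          ((-q) ^ crossings {j} (J.erase j) • (Y a j * minor q Y K (J.erase j)))) =
        if K ∈ (Finset.univ.erase a).powerset then (-q) ^ crossings {a} K • (N i a *
          (minor q N I K * minor q Y (insert a K) J)) else 0 := by
      intro K
      rw [← Finset.mul_sum, ← Finset.mul_sum]
      have := congrFun (LinearMap.congr_fun ((rowOp_isQExterior hq hY).mul_orderedProd a K)
        (Pi.single ∅ 1)) J
      rw [Module.End.mul_apply, rowOp_apply] at this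
      have h2 : ∑ j ∈ J, (-q) ^ crossings {j} (J.erase j) • (Y a j * minor q Y K (J.erase j)) =
        if a ∈ K then 0 else (-q) ^ crossings {a} K • minor q Y (insert a K) J := by
        refine this.trans ?_
        split_ifs <;> rfl
      rw [h2]
      by_cases ha : a ∈ K
      · rw [if_pos ha, if_neg, mul_zero, mul_zero]
        intro h'
        exact Finset.notMem_erase _ _ (Finset.mem_powerset.1 h' ha)
      · rw [if_neg ha, if_pos, mul_smul_comm, mul_smul_comm]
        exact Finset.mem_powerset.2 fun x hx => Finset.mem_erase.2
          ⟨fun h' => ha (h' ▸ hx), Finset.mem_univ x⟩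
    rw [Finset.sum_congr rfl fun K _ => hK K, ← Finset.sum_filter]
    congr 1
    ext K
    simp

lemma Finset.sum_sum_eq_sum_diag_add_sum_pairs {M : Type*} [AddCommMonoid M] (J : Finset κ)
    (F : κ → κ → M) :
    ∑ j ∈ J, ∑ l ∈ J, F j l =
      ∑ j ∈ J, F j j + ∑ j ∈ J, ∑ l ∈ J with j < l, (F j l + F l j) := by
  rw [← Finset.sum_sum_erase_eq_sum_pairs, ← Finset.sum_add_distrib]
  exact Finset.sum_congr rfl fun j hj => (Finset.add_sum_erase J _ hj).symm

/-- The product of two quantum matrices whose entries commute with each other is a quantum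
matrix. -/
lemma IsQMatrix.mul [Fintype ν] (hq : q ≠ 0) {N : ι → ν → B} {Y : ν → κ → B}
    (hN : IsQMatrix q N) (hY : IsQMatrix q Y) (h : ∀ i a b j, Commute (Y b j) (N i a)) :
    IsQMatrix q fun i j => ∑ a, N i a * Y a j := by
  have expand : ∀ i j h' l, (∑ a, N i a * Y a j) * (∑ a, N h' a * Y a l) =
      ∑ a, (N i a * N h' a) * (Y a j * Y a l) + ∑ a, ∑ b with a < b,
        ((N i a * N h' b) * (Y a j * Y b l) + (N i b * N h' a) * (Y b j * Y a l)) := by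
    intro i j h' l
    rw [Finset.sum_mul_sum, Finset.sum_sum_eq_sum_diag_add_sum_pairs]
    have e : ∀ a b, N i a * Y a j * (N h' b * Y b l) = (N i a * N h' b) * (Y a j * Y b l) := by
      intro a b
      rw [mul_assoc, ← mul_assoc (Y a j), (h h' b a j).eq]
      simp only [mul_assoc]
    simp only [e]
  refine ⟨?_, ?_, ?_, ?_⟩
  · intro i j l hj
    rw [expand, expand, smul_add, Finset.smul_sum, Finset.smul_sum]
    congr 1
    · refine Finset.sum_congr rfl fun a _ => ?_
      rw [hY.row a j l hj, mul_smul_comm]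
    · refine Finset.sum_congr rfl fun a _ => ?_
      rw [Finset.smul_sum]
      refine Finset.sum_congr rfl fun b hb => ?_
      replace hb := (Finset.mem_filter.1 hb).2
      rw [hN.row i a b hb, hY.diag _ _ _ _ hb hj, hY.antidiag _ _ _ _ hb hj]
      simp only [mul_add, smul_mul_assoc, mul_smul_comm]
      match_scalars <;> field_simp
      ring
  · intro i h' j hi
    rw [expand, expand, smul_add, Finset.smul_sum, Finset.smul_sum]
    congr 1
    · refine Finset.sum_congr rfl fun a _ => ?_
      rw [hN.col i h' a hi, smul_mul_assoc]
    · refine Finset.sum_congr rfl fun a _ => ?_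
      rw [Finset.smul_sum]
      refine Finset.sum_congr rfl fun b hb => ?_
      replace hb := (Finset.mem_filter.1 hb).2
      rw [hN.diag _ _ _ _ hi hb, hN.antidiag _ _ _ _ hi hb, hY.col _ _ _ hb]
      simp only [add_mul, smul_mul_assoc, mul_smul_comm]
      match_scalars <;> field_simp
      ring
  · intro i h' j l hi hj
    rw [expand, expand]
    congr 1
    · refine Finset.sum_congr rfl fun a _ => ?_
      rw [hN.col i h' a hi, hY.row _ _ _ hj, smul_mul_assoc, mul_smul_comm]
    · refine Finset.sum_congr rfl fun a _ => ?_
      refine Finset.sum_congr rfl fun b hb => ?_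
      replace hb := (Finset.mem_filter.1 hb).2
      rw [hN.diag _ _ _ _ hi hb, hN.antidiag _ _ _ _ hi hb, hY.diag _ _ _ _ hb hj,
        hY.antidiag _ _ _ _ hb hj]
      simp only [add_mul, mul_add, smul_mul_assoc, mul_smul_comm]
      match_scalars <;> field_simp
  · intro i h' j l hi hj
    rw [expand, expand, expand, smul_add, add_add_add_comm]
    refine congrArg₂ (· + ·) ?_ ?_
    · rw [Finset.smul_sum, ← Finset.sum_add_distrib]
      refine Finset.sum_congr rfl fun a _ => ?_
      rw [hN.col i h' a hi, hY.row _ _ _ hj]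
      simp only [smul_mul_assoc, mul_smul_comm]
      match_scalars <;> field_simp
      ring
    · rw [Finset.smul_sum, ← Finset.sum_add_distrib]
      refine Finset.sum_congr rfl fun a _ => ?_
      rw [Finset.smul_sum, ← Finset.sum_add_distrib]
      refine Finset.sum_congr rfl fun b hb => ?_
      replace hb := (Finset.mem_filter.1 hb).2
      rw [hN.diag _ _ _ _ hi hb, hN.antidiag _ _ _ _ hi hb, hY.diag _ _ _ _ hb hj,
        hY.antidiag _ _ _ _ hb hj]
      simp only [add_mul, mul_add, smul_mul_assoc, mul_smul_comm]
      match_scalars <;> field_simp <;> ring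

end Minors

section Straightening

variable {k : Type*} [Field k] {ι κ : Type*} [LinearOrder ι] [LinearOrder κ]

lemma crossings_singleton_eq_card {a : ι} {A : Finset ι} (h : ∀ b ∈ A, b < a) :
    crossings {a} A = A.card := by
  rw [crossings, Finset.sum_singleton, Finset.card_eq_sum_ones]
  exact Finset.sum_congr rfl fun b hb => if_pos (h b hb)

lemma crossings_eq_zero {A B : Finset ι} (h : ∀ a ∈ A, ∀ b ∈ B, a ≤ b) :
    crossings A B = 0 :=
  Finset.sum_eq_zero fun a ha => Finset.sum_eq_zero fun b hb => if_neg (h a ha b hb).not_gt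

/-- Functions on the `j`-element subsets of `U` are linear combinations of the functions
`T ↦ if R ⊆ T then p ^ crossings T R else 0` where `R` has at most `U.card - j` elements. -/
lemma exists_crossings_interpolation {p : k} (hp : p ≠ 0) (U : Finset ι) (j : ℕ)
    (f : Finset ι → k) :
    ∃ c : Finset ι → k, (∀ R, U.card < R.card + j → c R = 0) ∧
      ∀ T ⊆ U, T.card = j → ∑ R ∈ T.powerset, c R * p ^ crossings T R = f T := by
  induction U using Finset.induction_on_max generalizing j f with
  | empty =>
    refine ⟨fun R => if R.card + j = 0 then f ∅ else 0, fun R hR => if_neg ?_, fun T hT hj => ?_⟩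
    · rw [Finset.card_empty] at hR
      omega
    · obtain rfl := Finset.subset_empty.1 hT
      simp at hj
      simp [← hj, crossings_empty_left]
  | insert N U hN ih =>
    have hNU : N ∉ U := fun h => (hN N h).false
    have hcard := Finset.card_insert_of_notMem hNU
    rcases j with _ | j
    · obtain ⟨c, -, hc⟩ := ih 0 f
      refine ⟨fun R => if U.card < R.card then 0 else c R, fun R hR => if_pos (by omega), ?_⟩
      intro T _ hT
      obtain rfl := Finset.card_eq_zero.1 hT
      simpa using hc ∅ (Finset.empty_subset _) rfl
    obtain ⟨d, hd, hdf⟩ := ih j fun T => f (insert N T)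
    obtain ⟨c, hc, hcf⟩ := ih (j + 1) fun T =>
      f T - ∑ R ∈ T.powerset, (p ^ R.card)⁻¹ * d R * p ^ crossings T R
    refine ⟨fun R => if N ∈ R then - c (R.erase N) else (p ^ R.card)⁻¹ * d R + c R, ?_, ?_⟩
    · intro R hR
      dsimp only
      split_ifs with h
      · have := Finset.card_erase_add_one h
        rw [hc _ (by omega), neg_zero]
      · rw [hd _ (by omega), hc _ (by omega), mul_zero, zero_add]
    · intro T hT hTj
      by_cases hNT : N ∈ T
      · obtain ⟨T, hT', rfl⟩ : ∃ T', N ∉ T' ∧ T = insert N T' :=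
          ⟨T.erase N, Finset.notMem_erase _ _, (Finset.insert_erase hNT).symm⟩
        have hTU : T ⊆ U := (Finset.insert_subset_insert_iff hT').1 hT
        rw [Finset.card_insert_of_notMem hT'] at hTj
        rw [Finset.sum_powerset_insert hT', ← Finset.sum_add_distrib, ← hdf T hTU (by omega)]
        refine Finset.sum_congr rfl fun R hR => ?_
        rw [Finset.mem_powerset] at hR
        have hNR : N ∉ R := fun h => hT' (hR h)
        have hlt : ∀ b ∈ R, b < N := fun b hb => hN b (hTU (hR hb))
        dsimp only
        rw [if_neg hNR, if_pos (Finset.mem_insert_self _ _), Finset.erase_insert hNR,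
          crossings_insert_right _ hNR, crossings_eq_zero (A := insert N T) (B := {N}),
          crossings_insert_left hT', crossings_singleton_eq_card hlt, zero_add, pow_add]
        · field_simp
          ring
        · intro a ha b hb
          rw [Finset.mem_singleton.1 hb]
          rcases Finset.mem_insert.1 ha with rfl | ha
          exacts [le_rfl, (hN a (hTU ha)).le]
      · have hTU : T ⊆ U := (Finset.subset_insert_iff_of_notMem hNT).1 hT
        have := hcf T hTU hTj
        rw [eq_sub_iff_add_eq, ← Finset.sum_add_distrib] at this
        rw [← this]
        refine Finset.sum_congr rfl fun R hR => ?_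
        dsimp only
        rw [if_neg fun h => hNT (Finset.mem_powerset.1 hR h)]
        ring

/-- If a family of vectors indexed by the subsets of `D` satisfies, modulo a submodule `N`, the
relations coming from Plücker relations, then all its members are in `N` as soon as those with
standard index are. -/
lemma mem_of_crossings_relations [Finite ι] {M : Type*} [AddCommGroup M] [Module k M] {p : k}
    (hp : p ≠ 0) (D : Finset ι) (t : ℕ) (g : Finset ι → M) (N : Submodule k M)
    (hcard : ∀ T ⊆ D, T.card ≠ t → g T ∈ N)
    (hrel : ∀ Q ⊆ D, Q.card < t →
      ∑ T ∈ D.powerset, (if Q ⊆ T then p ^ crossings T Q else 0) • g T ∈ N)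
    (hstd : ∀ T ⊆ D, (∀ x, (T.filter (· ≤ x)).card ≤ ((D \ T).filter (· ≤ x)).card) → g T ∈ N)
    (T : Finset ι) (hT : T ⊆ D) : g T ∈ N := by
  have : Finite (Colex (Finset ι)) := inferInstanceAs (Finite (Finset ι))
  have : WellFoundedGT (Colex (Finset ι)) := Finite.to_wellFoundedGT
  induction h : toColex T using WellFoundedGT.induction generalizing T with
  | _ T' ih =>
  subst h
  by_cases htc : T.card ≠ t
  · exact hcard T hT htc
  push Not at htc
  by_cases hs : ∀ x, (T.filter (· ≤ x)).card ≤ ((D \ T).filter (· ≤ x)).card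
  · exact hstd T hT hs
  push Not at hs
  obtain ⟨x, hx⟩ := hs
  set U := D.filter (· ≤ x) with hU
  set S := T.filter (· ≤ x) with hS
  set Z := T.filter (fun a => ¬ a ≤ x) with hZ
  have hSU : S ⊆ U := Finset.filter_subset_filter _ hT
  have hUc : U.card = S.card + ((D \ T).filter (· ≤ x)).card := by
    rw [← Finset.card_union_of_disjoint]
    · rw [hU, hS, ← Finset.filter_union, Finset.union_sdiff_of_subset hT]
    · exact Finset.disjoint_filter_filter (Finset.disjoint_sdiff)
  have hSZ : S.card + Z.card = t := by
    rw [← htc, hS, hZ]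
    exact Finset.card_filter_add_card_filter_not _
  obtain ⟨c, hc0, hc⟩ := exists_crossings_interpolation hp U S.card
    (fun T₁ => if T₁ = S then 1 else 0)
  have hdisj : ∀ R ⊆ U, Disjoint Z R := by
    intro R hR
    refine Finset.disjoint_left.2 fun a ha hb => ?_
    exact (Finset.mem_filter.1 ha).2 (Finset.mem_filter.1 (hR hb)).2
  have hsum : ∑ R ∈ U.powerset, (c R * (p ^ crossings Z R)⁻¹) •
      ∑ T' ∈ D.powerset, (if Z ∪ R ⊆ T' then p ^ crossings T' (Z ∪ R) else 0) • g T' ∈ N := by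
    refine Submodule.sum_mem _ fun R hR => ?_
    rw [Finset.mem_powerset] at hR
    by_cases hRc : U.card < R.card + S.card
    · rw [hc0 R hRc, zero_mul, zero_smul]
      exact N.zero_mem
    · refine N.smul_mem _ (hrel _ (Finset.union_subset ((Finset.filter_subset _ _).trans hT)
        (hR.trans (Finset.filter_subset _ _))) ?_)
      rw [Finset.card_union_of_disjoint (hdisj R hR)]
      omega
  simp only [Finset.smul_sum] at hsum
  rw [Finset.sum_comm] at hsum
  simp only [smul_smul, ← Finset.sum_smul] at hsum
  have hcoeff : ∀ T' ⊆ D, T'.filter (fun a => ¬ a ≤ x) = Z → T'.card = t →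
      ∑ R ∈ U.powerset, c R * (p ^ crossings Z R)⁻¹ *
        (if Z ∪ R ⊆ T' then p ^ crossings T' (Z ∪ R) else 0) =
      if T' = T then p ^ crossings T Z else 0 := by
    intro T' hT' hZT' hT't
    have hTS : T'.filter (· ≤ x) ∪ Z = T' := by
      rw [← hZT']
      exact Finset.filter_union_filter_not_eq _ _
    have hdj : Disjoint (T'.filter (· ≤ x)) Z :=
      (hdisj _ (Finset.filter_subset_filter _ hT')).symm
    have hTS' : S ∪ Z = T := Finset.filter_union_filter_not_eq _ _
    have hcd := Finset.card_union_of_disjoint hdj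
    rw [hTS] at hcd
    have hiff : T' = T ↔ T'.filter (· ≤ x) = S := by
      constructor
      · rintro rfl
        rfl
      · intro h
        rw [← hTS, h, hTS']
    have h1 := hc (T'.filter (· ≤ x)) (Finset.filter_subset_filter _ hT') (by omega)
    calc _ = ∑ R ∈ (T'.filter (· ≤ x)).powerset,
          p ^ crossings T' Z * (c R * p ^ crossings (T'.filter (· ≤ x)) R) := by
          rw [← Finset.sum_subset (Finset.powerset_mono.2 (Finset.filter_subset_filter _ hT'))]
          · refine Finset.sum_congr rfl fun R hR => ?_
            rw [Finset.mem_powerset] at hR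
            have hRU : R ⊆ U := hR.trans (Finset.filter_subset_filter _ hT')
            rw [if_pos, crossings_union_right _ (hdisj R hRU)]
            · conv_lhs => rw [show crossings T' R = crossings (T'.filter (· ≤ x)) R +
                crossings Z R by rw [← crossings_union_left hdj, hTS]]
              rw [pow_add, pow_add]
              field_simp
            · conv_rhs => rw [← hTS]
              rw [Finset.union_comm]
              exact Finset.union_subset_union_left hR
          · intro R hRU hR
            rw [Finset.mem_powerset] at hRU hR
            rw [if_neg, mul_zero]
            refine fun h => hR fun a ha => Finset.mem_filter.2
              ⟨h (Finset.mem_union_right _ ha), (Finset.mem_filter.1 (hRU ha)).2⟩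
      _ = _ := by
          rw [← Finset.mul_sum, h1]
          by_cases h : T' = T
          · rw [if_pos h, if_pos (hiff.1 h), mul_one, h]
          · rw [if_neg h, if_neg (mt hiff.2 h), mul_zero]
  rw [← Finset.add_sum_erase _ _ (Finset.mem_powerset.2 hT), hcoeff T hT rfl htc, if_pos rfl]
    at hsum
  have hrest : ∀ T' ∈ D.powerset.erase T, (∑ R ∈ U.powerset, c R * (p ^ crossings Z R)⁻¹ *
        (if Z ∪ R ⊆ T' then p ^ crossings T' (Z ∪ R) else 0)) • g T' ∈ N := by
    intro T' hT'
    obtain ⟨hne, hT'⟩ := Finset.mem_erase.1 hT'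
    rw [Finset.mem_powerset] at hT'
    by_cases htc' : T'.card ≠ t
    · exact N.smul_mem _ (hcard _ hT' htc')
    push Not at htc'
    by_cases hZT' : T'.filter (fun a => ¬ a ≤ x) = Z
    · rw [hcoeff T' hT' hZT' htc', if_neg hne, zero_smul]
      exact N.zero_mem
    by_cases hsub : Z ⊆ T'
    · refine N.smul_mem _ (ih _ ?_ T' hT' rfl)
      rw [Finset.Colex.toColex_lt_toColex]
      refine ⟨hne.symm, fun a ha ha' => ?_⟩
      have hZsub : Z ⊆ T'.filter fun a => ¬ a ≤ x := fun b hb =>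
        Finset.mem_filter.2 ⟨hsub hb, (Finset.mem_filter.1 hb).2⟩
      obtain ⟨b, hb, hbZ⟩ := Finset.exists_of_ssubset (hZsub.ssubset_of_ne (Ne.symm hZT'))
      rw [Finset.mem_filter] at hb
      refine ⟨b, hb.1, fun hbT => hbZ (Finset.mem_filter.2 ⟨hbT, hb.2⟩), ?_⟩
      have hax : a ≤ x := by
        by_contra hax
        exact ha' (hsub (Finset.mem_filter.2 ⟨ha, hax⟩))
      exact hax.trans (not_le.1 hb.2).le
    · rw [Finset.sum_eq_zero, zero_smul]
      · exact N.zero_mem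
      · intro R _
        rw [if_neg fun h => hsub (Finset.union_subset_left h), mul_zero]
  have := (N.add_mem_iff_left (Submodule.sum_mem _ hrest)).1 hsum
  exact (N.smul_mem_iff (pow_ne_zero _ hp)).1 this

end Straightening

section MinorStraightening

variable {k : Type*} [Field k] {ι κ : Type*} [LinearOrder ι] [LinearOrder κ]
  {B : Type*} [Ring B] [Algebra k B] {q : k} {X : ι → κ → B}

/-- Quantum Plücker relations. -/
lemma minor_plucker (hq : q ≠ 0) (hX : IsQMatrix q X) (P Q : Finset ι) (J L : Finset κ) :
    ∑ W ∈ P.powerset, (if Disjoint (P \ W) Q then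
      (-q) ^ (crossings W (P \ W) + crossings (P \ W) Q) •
        (minor q X W J * minor q X (P \ W ∪ Q) L) else 0) =
    ∑ L₁ ∈ L.powerset, if Disjoint J L₁ then
      (-q) ^ (crossings L₁ (L \ L₁) + crossings J L₁) •
        (minor q X P (J ∪ L₁) * minor q X Q (L \ L₁)) else 0 := by
  have hl : ∀ W ∈ P.powerset, (if Disjoint (P \ W) Q then
      (-q) ^ (crossings W (P \ W) + crossings (P \ W) Q) •
        (minor q X W J * minor q X (P \ W ∪ Q) L) else 0) =
      ∑ L₁ ∈ L.powerset, (-q) ^ (crossings W (P \ W) + crossings L₁ (L \ L₁)) •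
        (minor q X W J * minor q X (P \ W) L₁ * minor q X Q (L \ L₁)) := by
    intro W _
    have h := congrArg (fun b => (-q) ^ crossings W (P \ W) • (minor q X W J * b))
      (sum_minor_mul_minor hq hX (P \ W) Q L)
    simp only [mul_ite, mul_zero, smul_ite, smul_zero, mul_smul_comm, smul_smul, ← pow_add,
      Finset.mul_sum, Finset.smul_sum, ← mul_assoc] at h
    exact h.symm
  have hr : ∀ L₁ ∈ L.powerset, (if Disjoint J L₁ then
      (-q) ^ (crossings L₁ (L \ L₁) + crossings J L₁) •
        (minor q X P (J ∪ L₁) * minor q X Q (L \ L₁)) else 0) =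
      ∑ W ∈ P.powerset, (-q) ^ (crossings W (P \ W) + crossings L₁ (L \ L₁)) •
        (minor q X W J * minor q X (P \ W) L₁ * minor q X Q (L \ L₁)) := by
    intro L₁ _
    have h := congrArg (fun b => (-q) ^ crossings L₁ (L \ L₁) • (b * minor q X Q (L \ L₁)))
      (sum_minor_mul_minor' hq hX P J L₁)
    simp only [ite_mul, zero_mul, smul_ite, smul_zero, smul_mul_assoc, smul_smul, ← pow_add,
      Finset.sum_mul, Finset.smul_sum, add_comm (crossings L₁ (L \ L₁)) (crossings _ (P \ _))]
      at h
    exact h.symm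
  rw [Finset.sum_congr rfl hl, Finset.sum_congr rfl hr, Finset.sum_comm]

/-- Two finite sets, viewed as columns of a tableau, are in standard position. -/
def IsStdPair (I K : Finset ι) : Prop :=
  ∀ x, (K.filter (· ≤ x)).card ≤ (I.filter (· ≤ x)).card

lemma Finset.val_union_of_disjoint {A C : Finset ι} (h : Disjoint A C) :
    (A ∪ C).val = A.val + C.val := by
  rw [← Finset.disjUnion_eq_union _ _ h]
  rfl

lemma Finset.card_eq_of_val_add_eq {I K I' K' : Finset ι}
    (h : I'.val + K'.val = I.val + K.val) : I'.card + K'.card = I.card + K.card := by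
  simpa using congrArg Multiset.card h

/-- Straightening of the row indices of a product of two quantum minors, modulo products in which
the first factor is of larger size. -/
lemma minor_mul_minor_mem_of_rows [Finite ι] (hq : q ≠ 0) (hX : IsQMatrix q X)
    (N : Submodule k B) (I K : Finset ι) (J L : Finset κ)
    (hlarge : ∀ P Q J' L', I.card < P.card → P.val + Q.val = I.val + K.val →
      J'.val + L'.val = J.val + L.val → minor q X P J' * minor q X Q L' ∈ N)
    (hstd : ∀ I' K', IsStdPair I' K' → I'.val + K'.val = I.val + K.val →
      minor q X I' J * minor q X K' L ∈ N) :
    minor q X I J * minor q X K L ∈ N := by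
  by_cases hIJ : I.card = J.card
  swap
  · rw [minor_eq_zero_of_card_ne q X hIJ, zero_mul]
    exact N.zero_mem
  set C := I ∩ K with hC
  set D := (I \ K) ∪ (K \ I) with hD
  have hCD : Disjoint C D := by
    rw [Finset.disjoint_left]
    simp only [hC, hD, Finset.mem_inter, Finset.mem_union, Finset.mem_sdiff]
    tauto
  have hCA : ∀ A ⊆ D, Disjoint C A := fun A hA => Finset.disjoint_of_subset_right hA hCD
  have eI : I = C ∪ (D \ (K \ I)) := by
    ext x
    simp only [hC, hD, Finset.mem_inter, Finset.mem_union, Finset.mem_sdiff]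
    tauto
  have eK : K = C ∪ (K \ I) := by
    ext x
    simp only [hC, Finset.mem_inter, Finset.mem_union, Finset.mem_sdiff]
    tauto
  have hKI : K \ I ⊆ D := Finset.subset_union_right
  have hval : ∀ T ⊆ D, (C ∪ (D \ T)).val + (C ∪ T).val = I.val + K.val := by
    have h : ∀ T ⊆ D, (C ∪ (D \ T)).val + (C ∪ T).val = C.val + C.val + D.val := by
      intro T hT
      rw [Finset.val_union_of_disjoint (hCA _ Finset.sdiff_subset),
        Finset.val_union_of_disjoint (hCA _ hT), add_add_add_comm,
        ← Finset.val_union_of_disjoint Finset.sdiff_disjoint, Finset.sdiff_union_of_subset hT]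
    intro T hT
    rw [h T hT, ← h _ hKI, ← eI, ← eK]
  have hcard : ∀ T ⊆ D, (C ∪ (D \ T)).card + T.card = C.card + D.card := by
    intro T hT
    rw [Finset.card_union_of_disjoint (hCA _ Finset.sdiff_subset), add_assoc,
      Finset.card_sdiff_add_card_eq_card hT]
  have hcardI : I.card + (K \ I).card = C.card + D.card := by
    have := hcard _ hKI
    rwa [← eI] at this
  have hz : (-q) ≠ 0 := neg_ne_zero.2 hq
  let e : Finset ι → ℕ := fun T => crossings C T + crossings T C + crossings (D \ T) T
  suffices h : ∀ T ⊆ D, (-q) ^ e T •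
      (minor q X (C ∪ (D \ T)) J * minor q X (C ∪ T) L) ∈ N by
    have := (N.smul_mem_iff (pow_ne_zero _ hz)).1 (h _ hKI)
    rwa [← eI, ← eK] at this
  refine mem_of_crossings_relations (p := (-q) ^ 2) (pow_ne_zero _ hz) D (K \ I).card _ N ?_ ?_ ?_
  · intro T hT hne
    rw [minor_eq_zero_of_card_ne q X, zero_mul, smul_zero]
    · exact N.zero_mem
    · have := hcard T hT
      omega
  · intro Q hQ hQc
    set P := C ∪ (D \ Q) with hP
    have hPc : I.card < P.card := by
      have := hcard Q hQ
      rw [← hP] at this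
      omega
    have hmem : ∑ W ∈ P.powerset, (if Disjoint (P \ W) (C ∪ Q) then
      (-q) ^ (crossings W (P \ W) + crossings (P \ W) (C ∪ Q)) •
        (minor q X W J * minor q X (P \ W ∪ (C ∪ Q)) L) else 0) ∈ N := by
      rw [minor_plucker hq hX]
      refine Submodule.sum_mem _ fun L₁ hL₁ => ?_
      split_ifs with hd
      · refine N.smul_mem _ (hlarge _ _ _ _ hPc (hval Q hQ) ?_)
        rw [Finset.val_union_of_disjoint hd, add_assoc,
          ← Finset.val_union_of_disjoint Finset.disjoint_sdiff,
          Finset.union_sdiff_of_subset (Finset.mem_powerset.1 hL₁)]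
      · exact N.zero_mem
    rw [← N.smul_mem_iff (pow_ne_zero (crossings C Q + crossings Q C + crossings D Q +
      crossings Q Q) hz), Finset.smul_sum] at hmem
    convert hmem using 1
    rw [← Finset.sum_filter_of_ne (p := fun T => Q ⊆ T), ← Finset.sum_filter_of_ne
      (s := P.powerset) (p := fun W => Disjoint (P \ W) (C ∪ Q))]
    · refine Finset.sum_bij' (fun T _ => C ∪ (D \ T)) (fun W _ => D \ W) ?_ ?_ ?_ ?_ ?_
      · intro T hT
        simp only [Finset.mem_filter, Finset.mem_powerset] at hT ⊢
        refine ⟨Finset.union_subset_union_right (Finset.sdiff_subset_sdiff subset_rfl hT.2), ?_⟩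
        rw [Finset.disjoint_left]
        intro a
        have h1 : a ∈ T → a ∈ D := fun h => hT.1 h
        have h2 : a ∈ Q → a ∈ T := fun h => hT.2 h
        have h3 : a ∈ C → a ∉ D := fun h => Finset.disjoint_left.1 hCD h
        simp only [hP, Finset.mem_union, Finset.mem_sdiff]
        tauto
      · intro W hW
        simp only [Finset.mem_filter, Finset.mem_powerset] at hW ⊢
        refine ⟨Finset.sdiff_subset, fun a ha => Finset.mem_sdiff.2 ⟨hQ ha, fun haW => ?_⟩⟩
        have := hW.1 haW
        simp only [hP, Finset.mem_union, Finset.mem_sdiff] at this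
        rcases this with h | h
        · exact Finset.disjoint_left.1 hCD h (hQ ha)
        · exact h.2 ha
      · intro T hT
        simp only [Finset.mem_filter, Finset.mem_powerset] at hT
        ext a
        have h1 : a ∈ T → a ∈ D := fun h => hT.1 h
        have h2 : a ∈ C → a ∉ D := fun h => Finset.disjoint_left.1 hCD h
        simp only [Finset.mem_union, Finset.mem_sdiff]
        tauto
      · intro W hW
        simp only [Finset.mem_filter, Finset.mem_powerset] at hW
        ext a
        have h1 : a ∈ W → a ∈ P := fun h => hW.1 h
        have h2 : a ∈ P \ W → a ∉ C ∪ Q := fun h => Finset.disjoint_left.1 hW.2 h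
        simp only [hP, Finset.mem_union, Finset.mem_sdiff] at h1 h2 ⊢
        tauto
      · intro T hT
        simp only [Finset.mem_filter, Finset.mem_powerset] at hT
        have hS : P \ (C ∪ (D \ T)) = T \ Q := by
          ext a
          have h1 : a ∈ T → a ∈ D := fun h => hT.1 h
          have h2 : a ∈ C → a ∉ D := fun h => Finset.disjoint_left.1 hCD h
          simp only [hP, Finset.mem_union, Finset.mem_sdiff]
          tauto
        have hSQ : T \ Q ∪ (C ∪ Q) = C ∪ T := by
          rw [Finset.union_left_comm, Finset.sdiff_union_of_subset hT.2]
        have hdis : Disjoint (T \ Q) (C ∪ Q) := by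
          rw [Finset.disjoint_union_right]
          exact ⟨(hCA _ (Finset.sdiff_subset.trans hT.1)).symm, Finset.sdiff_disjoint⟩
        rw [hS, hSQ, if_pos hT.2, if_pos hdis, smul_smul, smul_smul, ← pow_mul, ← pow_add,
          ← pow_add]
        congr 2
        have c1 : crossings (C ∪ D \ T) (T \ Q) = crossings C (T \ Q) +
          crossings (D \ T) (T \ Q) := crossings_union_left (hCA _ Finset.sdiff_subset) _
        have c2 : crossings (T \ Q) (C ∪ Q) = crossings (T \ Q) C + crossings (T \ Q) Q :=
          crossings_union_right _ (hCA _ hQ)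
        have right : ∀ A, crossings A T = crossings A (T \ Q) + crossings A Q := fun A => by
          rw [← crossings_union_right _ Finset.sdiff_disjoint, Finset.sdiff_union_of_subset hT.2]
        have left : ∀ A, crossings T A = crossings (T \ Q) A + crossings Q A := fun A => by
          rw [← crossings_union_left Finset.sdiff_disjoint, Finset.sdiff_union_of_subset hT.2]
        have c3 : crossings D Q = crossings (D \ T) Q + crossings T Q := by
          rw [← crossings_union_left Finset.sdiff_disjoint, Finset.sdiff_union_of_subset hT.1]
        have c4 := right C
        have c5 := right (D \ T)
        have c6 := left C
        have c7 := left Q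
        change 2 * _ + (crossings C T + crossings T C + crossings (D \ T) T) = _
        omega
    · intro W _ hne
      by_contra h
      exact hne (by rw [if_neg h, smul_zero])
    · intro T _ hne
      by_contra h
      exact hne (by rw [if_neg h, zero_smul])
  · intro T hT hs
    refine N.smul_mem _ (hstd _ _ ?_ (hval T hT))
    intro x
    rw [Finset.filter_union, Finset.filter_union, Finset.card_union_of_disjoint,
      Finset.card_union_of_disjoint]
    · exact Nat.add_le_add_left (hs x) _
    · exact Finset.disjoint_filter_filter (hCA _ Finset.sdiff_subset)
    · exact Finset.disjoint_filter_filter (hCA _ hT)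

/-- A product of two quantum minors is a linear combination of standard products of two quantum
minors with the same contents. -/
theorem minor_mul_minor_mem_span [Finite ι] [Finite κ] (hq : q ≠ 0) (hX : IsQMatrix q X)
    (I K : Finset ι) (J L : Finset κ) :
    minor q X I J * minor q X K L ∈ Submodule.span k {x | ∃ I' K' J' L',
      IsStdPair I' K' ∧ IsStdPair J' L' ∧ I'.card = J'.card ∧ K'.card = L'.card ∧
      I'.val + K'.val = I.val + K.val ∧ J'.val + L'.val = J.val + L.val ∧
      x = minor q X I' J' * minor q X K' L'} := by
  obtain ⟨N, hN⟩ : ∃ N, N = Submodule.span k {x | ∃ I' K' J' L',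
      IsStdPair I' K' ∧ IsStdPair J' L' ∧ I'.card = J'.card ∧ K'.card = L'.card ∧
      I'.val + K'.val = I.val + K.val ∧ J'.val + L'.val = J.val + L.val ∧
      x = minor q X I' J' * minor q X K' L'} := ⟨_, rfl⟩
  rw [← hN]
  suffices h : ∀ d : ℕ, ∀ I' K' J' L', d = K'.card → I'.val + K'.val = I.val + K.val →
      J'.val + L'.val = J.val + L.val → minor q X I' J' * minor q X K' L' ∈ N from
    h _ I K J L rfl rfl rfl
  intro d
  induction d using Nat.strong_induction_on with
  | _ d ih =>
  intro I' K' J' L' hd hI hJ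
  subst hd
  by_cases hIJ : I'.card = J'.card
  swap
  · rw [minor_eq_zero_of_card_ne q X hIJ, zero_mul]
    exact N.zero_mem
  have hlarge : ∀ P Q J'' L'', I'.card < P.card → P.val + Q.val = I.val + K.val →
      J''.val + L''.val = J.val + L.val → minor q X P J'' * minor q X Q L'' ∈ N := by
    intro P Q J'' L'' hP hPQ hJL
    refine ih Q.card ?_ P Q J'' L'' rfl hPQ hJL
    have h1 := Finset.card_eq_of_val_add_eq hPQ
    have h2 := Finset.card_eq_of_val_add_eq hI
    omega
  refine minor_mul_minor_mem_of_rows hq hX N I' K' J' L' (fun P Q J'' L'' hP hPQ hJL =>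
    hlarge P Q J'' L'' hP (hPQ.trans hI) (hJL.trans hJ)) fun I'' K'' hs hIK => ?_
  rw [← minor_transpose hX, ← minor_transpose hX K'']
  refine minor_mul_minor_mem_of_rows hq hX.transpose N J' L' I'' K''
    (fun P Q J'' L'' hP hPQ hJL => ?_) fun J'' L'' hs' hJL => ?_
  · rw [minor_transpose hX, minor_transpose hX]
    by_cases hc : J''.card = P.card
    · exact hlarge _ _ _ _ (by omega) (hJL.trans (hIK.trans hI)) (hPQ.trans hJ)
    · rw [minor_eq_zero_of_card_ne q X hc, zero_mul]
      exact N.zero_mem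
  · rw [minor_transpose hX, minor_transpose hX]
    by_cases hc : I''.card = J''.card
    · by_cases hc' : K''.card = L''.card
      · rw [hN]
        exact Submodule.subset_span ⟨I'', K'', J'', L'', hs, hs', hc, hc', hIK.trans hI,
          hJL.trans hJ, rfl⟩
      · rw [minor_eq_zero_of_card_ne q X hc', mul_zero]
        exact N.zero_mem
    · rw [minor_eq_zero_of_card_ne q X hc, zero_mul]
      exact N.zero_mem

end MinorStraightening

section LeadingTerms

variable {k : Type*} [Field k] {G : Type*} [AddCommGroup G] {w : G →+ ℤ}

/-- An operator on `G →₀ k` raising the weight by at most `c`. -/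
def RaisesAtMost (w : G →+ ℤ) (c : ℤ) (b : Module.End k (G →₀ k)) : Prop :=
  ∀ h, b (Finsupp.single h 1) ∈ Finsupp.supported k k {h' | w h' ≤ w h + c}

/-- An operator on `G →₀ k` which is translation by `g` up to nonzero scalars and terms of lower
weight. -/
def HasLead (w : G →+ ℤ) (g : G) (b : Module.End k (G →₀ k)) : Prop :=
  ∀ h, ∃ c : k, c ≠ 0 ∧ b (Finsupp.single h 1) - Finsupp.single (h + g) c ∈
    Finsupp.supported k k {h' | w h' ≤ w h + w g - 1}

variable {c c' : ℤ} {g g' : G} {b b' : Module.End k (G →₀ k)}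

lemma RaisesAtMost.apply_mem (hb : RaisesAtMost w c b) {d : ℤ} {v : G →₀ k}
    (hv : v ∈ Finsupp.supported k k {h | w h ≤ d}) :
    b v ∈ Finsupp.supported k k {h | w h ≤ d + c} := by
  rw [Finsupp.supported_eq_span_single] at hv
  induction hv using Submodule.span_induction with
  | mem x hx =>
    obtain ⟨h, hh, rfl⟩ := hx
    refine Finsupp.supported_mono (fun h' hh' => ?_) (hb h)
    simp only [Set.mem_ofPred_eq] at hh hh' ⊢
    omega
  | zero => simp
  | add x y _ _ hx hy =>
    rw [map_add]
    exact Submodule.add_mem _ hx hy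
  | smul a x _ hx =>
    rw [map_smul]
    exact Submodule.smul_mem _ _ hx

lemma RaisesAtMost.mono (hb : RaisesAtMost w c b) (h : c ≤ c') : RaisesAtMost w c' b :=
  fun x => Finsupp.supported_mono (fun h' hh' => by
    simp only [Set.mem_ofPred_eq] at hh' ⊢
    omega) (hb x)

lemma RaisesAtMost.zero : RaisesAtMost w c (0 : Module.End k (G →₀ k)) := fun h => by simp

lemma RaisesAtMost.add (hb : RaisesAtMost w c b) (hb' : RaisesAtMost w c b') :
    RaisesAtMost w c (b + b') := fun h => Submodule.add_mem _ (hb h) (hb' h)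

lemma RaisesAtMost.smul (hb : RaisesAtMost w c b) (a : k) : RaisesAtMost w c (a • b) :=
  fun h => Submodule.smul_mem _ _ (hb h)

lemma RaisesAtMost.sum {α : Type*} {s : Finset α} {f : α → Module.End k (G →₀ k)}
    (hf : ∀ a ∈ s, RaisesAtMost w c (f a)) : RaisesAtMost w c (∑ a ∈ s, f a) :=
  Finset.sum_induction f _ (fun _ _ h h' => h.add h') .zero hf

lemma RaisesAtMost.mul (hb : RaisesAtMost w c b) (hb' : RaisesAtMost w c' b') :
    RaisesAtMost w (c + c') (b * b') := fun h => by
  rw [add_comm c, ← add_assoc]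
  exact hb.apply_mem (hb' h)

lemma HasLead.raisesAtMost (hb : HasLead w g b) : RaisesAtMost w (w g) b := fun h => by
  obtain ⟨c, -, hc⟩ := hb h
  have := Submodule.add_mem (Finsupp.supported k k {h' | w h' ≤ w h + w g})
    (Finsupp.supported_mono (fun h' hh' => ?_) hc) (Finsupp.single_mem_supported k c
      (a := h + g) ?_)
  · simpa using this
  · simp only [Set.mem_ofPred_eq] at hh' ⊢
    omega
  · simp

lemma HasLead.one : HasLead w 0 (1 : Module.End k (G →₀ k)) := fun h => ⟨1, one_ne_zero, by simp⟩

lemma HasLead.smul (hb : HasLead w g b) {a : k} (ha : a ≠ 0) : HasLead w g (a • b) := fun h => by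
  obtain ⟨c, hc0, hc⟩ := hb h
  refine ⟨a * c, mul_ne_zero ha hc0, ?_⟩
  rw [LinearMap.smul_apply, ← smul_eq_mul, ← Finsupp.smul_single, ← smul_sub]
  exact Submodule.smul_mem _ a hc

lemma HasLead.add_lower (hb : HasLead w g b) (hb' : RaisesAtMost w (w g - 1) b') :
    HasLead w g (b + b') := fun h => by
  obtain ⟨c, hc0, hc⟩ := hb h
  refine ⟨c, hc0, ?_⟩
  have h1 : b' (Finsupp.single h 1) ∈ Finsupp.supported k k {h' | w h' ≤ w h + w g - 1} := by
    simpa only [add_sub_assoc] using hb' h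
  have h2 : (b + b') (Finsupp.single h 1) - Finsupp.single (h + g) c =
      (b (Finsupp.single h 1) - Finsupp.single (h + g) c) + b' (Finsupp.single h 1) := by
    rw [LinearMap.add_apply, add_sub_right_comm]
  rw [h2]
  exact Submodule.add_mem _ hc h1

lemma HasLead.mul (hb : HasLead w g b) (hb' : HasLead w g' b') :
    HasLead w (g + g') (b * b') := fun h => by
  obtain ⟨c', hc0', hc'⟩ := hb' h
  obtain ⟨c, hc0, hc⟩ := hb (h + g')
  refine ⟨c' * c, mul_ne_zero hc0' hc0, ?_⟩
  have h1 := hb.raisesAtMost.apply_mem (d := w h + w g' - 1) hc'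
  have h2 := Submodule.smul_mem _ c' hc
  rw [map_sub, ← mul_one c', ← smul_eq_mul c', ← Finsupp.smul_single, map_smul] at h1
  rw [smul_sub, Finsupp.smul_single, smul_eq_mul] at h2
  have h3 := Submodule.add_mem (Finsupp.supported k k {h' | w h' ≤ w h + w (g + g') - 1})
    (Finsupp.supported_mono (fun h' hh' => ?_) h1) (Finsupp.supported_mono (fun h' hh' => ?_) h2)
  · rw [sub_add_sub_cancel, add_right_comm, add_assoc] at h3
    exact h3
  · simp only [Set.mem_ofPred_eq, map_add] at hh' ⊢
    omega
  · simp only [Set.mem_ofPred_eq, map_add] at hh' ⊢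
    omega

lemma HasLead.prod {α : Type*} (l : List α) {f : α → Module.End k (G →₀ k)} {e : α → G}
    (h : ∀ a ∈ l, HasLead w (e a) (f a)) : HasLead w (l.map e).sum (l.map f).prod := by
  induction l with
  | nil => exact .one
  | cons a l ih =>
    simp only [List.map_cons, List.sum_cons, List.prod_cons]
    exact (h a List.mem_cons_self).mul (ih fun b hb => h b (List.mem_cons_of_mem _ hb))

lemma RaisesAtMost.prod {α : Type*} (l : List α) {f : α → Module.End k (G →₀ k)} {e : α → ℤ}
    (h : ∀ a ∈ l, RaisesAtMost w (e a) (f a)) :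
    RaisesAtMost w (l.map e).sum (l.map f).prod := by
  induction l with
  | nil => simpa using (HasLead.one (k := k) (w := w)).raisesAtMost
  | cons a l ih =>
    simp only [List.map_cons, List.sum_cons, List.prod_cons]
    exact (h a List.mem_cons_self).mul (ih fun b hb => h b (List.mem_cons_of_mem _ hb))

/-- Operators with pairwise different leading exponents are linearly independent. -/
lemma eq_zero_of_sum_smul_hasLead {α : Type*} {f : α → Module.End k (G →₀ k)} {e : α → G}
    {s : Finset α} (he : Set.InjOn e s) (h : ∀ a ∈ s, HasLead w (e a) (f a)) {c : α → k}
    (hc : ∑ a ∈ s, c a • f a = 0) : ∀ a ∈ s, c a = 0 := by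
  classical
  by_contra! hne
  obtain ⟨a₀, ha₀, hca₀⟩ := hne
  obtain ⟨a, ha, hmax⟩ := (s.filter fun a => c a ≠ 0).exists_max_image (fun a => w (e a))
    ⟨a₀, Finset.mem_filter.2 ⟨ha₀, hca₀⟩⟩
  rw [Finset.mem_filter] at ha
  have hzero := DFunLike.congr_fun (DFunLike.congr_fun hc (Finsupp.single 0 1)) (e a)
  simp only [LinearMap.sum_apply, LinearMap.smul_apply, LinearMap.zero_apply,
    Finsupp.finsetSum_apply, Finsupp.smul_apply, Finsupp.zero_apply] at hzero
  rw [Finset.sum_eq_single a] at hzero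
  · obtain ⟨d, hd0, hd⟩ := h a ha.1 0
    have h1 := (Finsupp.mem_supported' k _).1 hd (e a) (by simp)
    simp only [zero_add, Finsupp.sub_apply, Finsupp.single_eq_same, sub_eq_zero] at h1
    rw [h1, smul_eq_mul] at hzero
    exact (mul_ne_zero ha.2 hd0) hzero
  · intro b hb hba
    by_cases hcb : c b = 0
    · simp [hcb]
    have hle := hmax b (Finset.mem_filter.2 ⟨hb, hcb⟩)
    obtain ⟨d, -, hd⟩ := h b hb 0
    have h1 := (Finsupp.mem_supported' k _).1 hd (e a) (by
      simp only [map_zero, zero_add, Set.mem_ofPred_eq]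
      omega)
    rw [zero_add, Finsupp.sub_apply, Finsupp.single_eq_of_ne (fun h' => hba (he hb ha.1 h'.symm)),
      sub_zero] at h1
    rw [h1, smul_zero]
  · exact fun h' => (h' ha.1).elim

lemma HasLead.ne_zero (hb : HasLead w g b) : b ≠ 0 := by
  intro h
  have := eq_zero_of_sum_smul_hasLead (s := {()}) (f := fun _ => b) (e := fun _ => g)
    (c := fun _ => (1 : k)) (fun _ _ _ _ _ => rfl) (fun _ _ => hb) (by simp [h]) () (by simp)
  exact one_ne_zero this

/-- The operator `single h ↦ q ^ L h • single (h + g)`. -/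
noncomputable def weylOp (q : k) (L : G →+ ℤ) (g : G) : Module.End k (G →₀ k) :=
  Finsupp.linearCombination k fun h => Finsupp.single (h + g) (q ^ L h)

lemma weylOp_single (q : k) (L : G →+ ℤ) (g h : G) :
    weylOp q L g (Finsupp.single h 1) = Finsupp.single (h + g) (q ^ L h) := by
  simp [weylOp]

lemma weylOp_mul {q : k} (hq : q ≠ 0) (L L' : G →+ ℤ) (g g' : G) :
    weylOp q L g * weylOp q L' g' = q ^ L g' • weylOp q (L + L') (g + g') := by
  refine Finsupp.lhom_ext' fun h => LinearMap.ext_ring ?_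
  simp only [LinearMap.comp_apply, Finsupp.lsingle_apply, Module.End.mul_apply, weylOp_single,
    LinearMap.smul_apply, Finsupp.smul_single, smul_eq_mul, AddMonoidHom.add_apply]
  rw [← mul_one (q ^ L' h), ← smul_eq_mul, ← Finsupp.smul_single, map_smul, weylOp_single,
    Finsupp.smul_single, smul_eq_mul, map_add, zpow_add₀ hq, zpow_add₀ hq]
  congr 1
  · abel
  · ring

lemma weylOp_comm {q : k} (hq : q ≠ 0) (L L' : G →+ ℤ) (g g' : G) :
    weylOp q L g * weylOp q L' g' = q ^ (L g' - L' g) • (weylOp q L' g' * weylOp q L g) := by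
  rw [weylOp_mul hq, weylOp_mul hq, smul_smul, ← zpow_add₀ hq, sub_add_cancel, add_comm L,
    add_comm g]

lemma weylOp_hasLead {q : k} (hq : q ≠ 0) (L : G →+ ℤ) (g : G) : HasLead w g (weylOp q L g) :=
  fun h => ⟨q ^ L h, zpow_ne_zero _ hq, by simp [weylOp_single]⟩

end LeadingTerms

section LayerOperators

variable {k : Type*} [Field k] {C ρ : Type*} [DecidableEq C] [LinearOrder ρ]

/-- The additive form on `Ω →₀ ℤ` taking the value `f ω` on the basis vector at `ω`. -/
noncomputable def linForm {Ω : Type*} (f : Ω → ℤ) : (Ω →₀ ℤ) →+ ℤ :=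
  Finsupp.liftAddHom fun ω => AddMonoidHom.mulLeft (f ω)

@[simp]
lemma linForm_single {Ω : Type*} (f : Ω → ℤ) (ω : Ω) (z : ℤ) :
    linForm f (Finsupp.single ω z) = f ω * z := by
  simp [linForm]

/-- The form summing the coordinates of layer `c` beyond `i`. -/
noncomputable def aboveForm (c : C) (i : ρ) : (C × ρ →₀ ℤ) →+ ℤ :=
  linForm fun ω => if ω.1 = c ∧ i < ω.2 then 1 else 0

/-- The form `h ↦ h (c, j) - aboveForm c j h`. -/
noncomputable def atSubAboveForm (c : C) (j : ρ) : (C × ρ →₀ ℤ) →+ ℤ :=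
  linForm fun ω => if ω.1 = c then (if j < ω.2 then -1 else if ω.2 = j then 1 else 0) else 0

/-- The basis vector at row `i` of layer `c`. -/
noncomputable def unitVec (c : C) (i : ρ) : C × ρ →₀ ℤ := Finsupp.single (c, i) 1

/-- The product of a raising operator at `i` and a lowering operator at `j` in layer `c`. -/
noncomputable def layerOp (q : k) (c : C) (i j : ρ) : Module.End k ((C × ρ →₀ ℤ) →₀ k) :=
  weylOp q (aboveForm c i) (unitVec c i) * weylOp q (atSubAboveForm c j) (-unitVec c j)

/-- The common monomial underlying the products `layerOp q c i j * layerOp q c h l`. -/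
noncomputable def layerPairOp (q : k) (c : C) (i h j l : ρ) :
    Module.End k ((C × ρ →₀ ℤ) →₀ k) :=
  weylOp q (aboveForm c i + aboveForm c h + (atSubAboveForm c j + atSubAboveForm c l))
    (unitVec c i + unitVec c h - (unitVec c j + unitVec c l))

lemma layerPairOp_swap_left (q : k) (c : C) (i h j l : ρ) :
    layerPairOp q c h i j l = layerPairOp q c i h j l := by
  rw [layerPairOp, layerPairOp, add_comm (aboveForm c h), add_comm (unitVec c h)]

lemma layerPairOp_swap_right (q : k) (c : C) (i h j l : ρ) :
    layerPairOp q c i h l j = layerPairOp q c i h j l := by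
  rw [layerPairOp, layerPairOp, add_comm (atSubAboveForm c l), add_comm (unitVec c l)]

variable {q : k}

lemma layerOp_mul_layerOp (hq : q ≠ 0) (c : C) (i j h l : ρ) :
    layerOp q c i j * layerOp q c h l =
      q ^ ((if i < h then 1 else 0) - (if i < j then 1 else 0) - (if i < l then 1 else 0)
        - (if h < l then 1 else 0) +
        ((if j < h then -1 else if h = j then 1 else 0) -
          (if j < l then -1 else if l = j then 1 else 0)) : ℤ) • layerPairOp q c i h j l := by
  rw [layerOp, layerOp, weylOp_mul hq, weylOp_mul hq, smul_mul_smul_comm, weylOp_mul hq,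
    smul_smul, ← zpow_add₀ hq, ← zpow_add₀ hq, layerPairOp]
  congr 2
  · simp only [unitVec, map_neg, map_add, AddMonoidHom.add_apply, aboveForm, atSubAboveForm,
      linForm_single, true_and, if_true, mul_one]
    ring
  · exact add_add_add_comm _ _ _ _
  · abel

lemma layerOp_commute (hq : q ≠ 0) {c d : C} (h : c ≠ d) (i j i' j' : ρ) :
    Commute (layerOp q c i j) (layerOp q d i' j') := by
  have key : ∀ (L L' : (C × ρ →₀ ℤ) →+ ℤ) (g g' : C × ρ →₀ ℤ), L g' = 0 → L' g = 0 →
      Commute (weylOp q L g) (weylOp q L' g') := by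
    intro L L' g g' h1 h2
    rw [Commute, SemiconjBy, weylOp_comm hq, h1, h2, sub_zero, zpow_zero, one_smul]
  have h' := h.symm
  apply Commute.mul_left <;> apply Commute.mul_right <;> apply key <;>
    simp [unitVec, aboveForm, atSubAboveForm, h, h']

lemma layerOp_hasLead (hq : q ≠ 0) (w : (C × ρ →₀ ℤ) →+ ℤ) (c : C) (i j : ρ) :
    HasLead w (unitVec c i - unitVec c j) (layerOp q c i j) := by
  rw [sub_eq_add_neg]
  exact (weylOp_hasLead hq _ _).mul (weylOp_hasLead hq _ _)

/-- The upper triangular matrix of a single layer, with nonzero off-diagonal entries in the rows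
satisfying `p`. -/
noncomputable def layerMatrix (q : k) (c : C) (p : ρ → Prop) [DecidablePred p] (i j : ρ) :
    Module.End k ((C × ρ →₀ ℤ) →₀ k) :=
  if i = j ∨ i < j ∧ p i then layerOp q c i j else 0

variable {p : ρ → Prop} [DecidablePred p]

lemma layerMatrix_of (c : C) {i j : ρ} (h : i = j ∨ i < j ∧ p i) :
    layerMatrix q c p i j = layerOp q c i j := if_pos h

lemma layerMatrix_eq_zero (c : C) {i j : ρ} (h : ¬(i = j ∨ i < j ∧ p i)) :
    layerMatrix q c p i j = 0 := if_neg h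

lemma layerMatrix_isQMatrix (hq : q ≠ 0) (c : C) (hp : ∀ i j, i ≤ j → p i → p j) :
    IsQMatrix q (layerMatrix q c p) := by
  constructor
  · intro i j l hjl
    by_cases h1 : i = j ∨ i < j ∧ p i
    · by_cases h2 : i = l ∨ i < l ∧ p i
      · have hij : i ≤ j := h1.elim le_of_eq fun h => h.1.le
        have hil : i < l := hij.trans_lt hjl
        rw [layerMatrix_of c h1, layerMatrix_of c h2, layerOp_mul_layerOp hq,
          layerOp_mul_layerOp hq, layerPairOp_swap_right, smul_smul, ← zpow_one_add₀ hq]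
        congr 2
        rcases hij.eq_or_lt with rfl | hij
        · simp [hil, hil.not_gt, hil.ne]
        · simp [hij, hij.not_gt, hij.ne, hil, hil.not_gt, hil.ne, hjl, hjl.not_gt, hjl.ne]
      · simp [layerMatrix_eq_zero c h2]
    · simp [layerMatrix_eq_zero c h1]
  · intro i h j hih
    by_cases h1 : i = j ∨ i < j ∧ p i
    · by_cases h2 : h = j ∨ h < j ∧ p h
      · have hhj : h ≤ j := h2.elim le_of_eq fun h => h.1.le
        have hij : i < j := hih.trans_le hhj
        rw [layerMatrix_of c h1, layerMatrix_of c h2, layerOp_mul_layerOp hq,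
          layerOp_mul_layerOp hq, layerPairOp_swap_left, smul_smul, ← zpow_one_add₀ hq]
        congr 2
        rcases hhj.eq_or_lt with rfl | hhj
        · simp [hij, hij.not_gt, hij.ne]
        · simp [hij, hij.not_gt, hij.ne, hih, hih.not_gt, hhj, hhj.not_gt, hhj.ne]
      · simp [layerMatrix_eq_zero c h2]
    · simp [layerMatrix_eq_zero c h1]
  · intro i h j l hih hjl
    by_cases h1 : h = j ∨ h < j ∧ p h
    · by_cases h2 : i = l ∨ i < l ∧ p i
      · have hhj : h ≤ j := h1.elim le_of_eq fun h => h.1.le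
        have hij : i < j := hih.trans_le hhj
        have hhl : h < l := hhj.trans_lt hjl
        have hil : i < l := hih.trans hhl
        rw [layerMatrix_of c h1, layerMatrix_of c h2, layerOp_mul_layerOp hq,
          layerOp_mul_layerOp hq, layerPairOp_swap_right, layerPairOp_swap_left]
        congr 2
        simp [hij, hij.not_gt, hij.ne, hih, hih.not_gt, hjl, hjl.not_gt, hjl.ne, hil, hhl,
          hhl.not_gt, hhl.ne]
        ring
      · simp [layerMatrix_eq_zero c h2]
    · simp [layerMatrix_eq_zero c h1]
  · intro i h j l hih hjl
    by_cases h1 : i = j ∨ i < j ∧ p i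
    · by_cases h2 : h = l ∨ h < l ∧ p h
      · rcases le_or_gt h j with hhj | hjh
        · have hij : i < j := hih.trans_le hhj
          have hhl : h < l := hhj.trans_lt hjl
          have hil : i < l := hih.trans hhl
          have hpi : p i := (h1.resolve_left hij.ne).2
          rw [layerMatrix_of c h1, layerMatrix_of c h2, layerMatrix_of c (Or.inr ⟨hil, hpi⟩),
            layerMatrix_of c (j := j) (hhj.eq_or_lt.imp id fun hh => ⟨hh, hp i h hih.le hpi⟩),
            layerOp_mul_layerOp hq, layerOp_mul_layerOp hq, layerOp_mul_layerOp hq,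
            layerPairOp_swap_right (j := j) (l := l), layerPairOp_swap_left (i := i) (h := h),
            layerPairOp_swap_right (j := j) (l := l), smul_smul, ← add_smul]
          congr 1
          rcases hhj.eq_or_lt with rfl | hhj
          · simp [hih, hih.not_gt, hil, hil.not_gt, hil.ne, hhl, hhl.not_gt, hhl.ne]
            field_simp
            ring
          · simp [hij, hih, hih.not_gt, hjl, hjl.not_gt, hjl.ne, hil, hil.not_gt, hil.ne, hhl,
              hhl.not_gt, hhl.ne, hhj, hhj.not_gt, hhj.ne, hhj.ne']
            field_simp
            ring
        · have hij : i ≤ j := h1.elim le_of_eq fun h => h.1.le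
          have hhl : h ≤ l := h2.elim le_of_eq fun h => h.1.le
          have hil : i < l := hij.trans_lt hjl
          rw [layerMatrix_of c h1, layerMatrix_of c h2, layerMatrix_eq_zero c (i := h) (j := j)
            (by rintro (hh | hh); exacts [hjh.ne' hh, hjh.not_gt hh.1]), mul_zero, smul_zero,
            add_zero, layerOp_mul_layerOp hq, layerOp_mul_layerOp hq,
            layerPairOp_swap_right, layerPairOp_swap_left]
          congr 2
          rcases hij.eq_or_lt with rfl | hij <;> rcases hhl.eq_or_lt with rfl | hhl <;>
          simp [*, hih.not_gt, hih.ne, hih.ne', hjh.not_gt, hjh.ne, hjh.ne',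
              hjl.not_gt, hjl.ne, hjl.ne', hil.not_gt, hil.ne, hil.ne', LT.lt.not_gt, LT.lt.ne,
              LT.lt.ne']
      · have h3 : ¬((i = l ∨ i < l ∧ p i) ∧ (h = j ∨ h < j ∧ p h)) := by
          rintro ⟨h3, h4⟩
          have hhj : h ≤ j := h4.elim le_of_eq fun h => h.1.le
          have hhl : h < l := hhj.trans_lt hjl
          have hil : i < l := hih.trans hhl
          exact h2 (Or.inr ⟨hhl, hp i h hih.le (h3.resolve_left hil.ne).2⟩)
        rw [layerMatrix_eq_zero c h2]
        rcases not_and_or.1 h3 with h3 | h3 <;> simp [layerMatrix_eq_zero c h3]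
    · have h3 : ¬((i = l ∨ i < l ∧ p i) ∧ (h = j ∨ h < j ∧ p h)) := by
        rintro ⟨h3, h4⟩
        have hhj : h ≤ j := h4.elim le_of_eq fun h => h.1.le
        have hhl : h < l := hhj.trans_lt hjl
        have hil : i < l := hih.trans hhl
        exact h1 (Or.inr ⟨hih.trans_le hhj, (h3.resolve_left hil.ne).2⟩)
      rw [layerMatrix_eq_zero c h1]
      rcases not_and_or.1 h3 with h3 | h3 <;> simp [layerMatrix_eq_zero c h3]

end LayerOperators

section Tower

variable {k : Type*} [Field k] {n : ℕ}

/-- Replace the last row of `X` by the unit vector at `s`. -/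
def resetLast {B : Type*} [Semiring B] (s : ℕ) (X : Fin (n + 1) → ℕ → B) (d : Fin (n + 1)) (l : ℕ) :
    B :=
  if d = Fin.last n then (if l = s then 1 else 0) else X d l

lemma IsQMatrix.resetLast {B : Type*} [Semiring B] [Algebra k B] {q : k} {s : ℕ}
    {X : Fin (n + 1) → ℕ → B} (hX : IsQMatrix q X) (h0 : ∀ i l, s ≤ l → X i l = 0) :
    IsQMatrix q (resetLast s X) := by
  constructor
  · intro i j l hjl
    by_cases hi : i = Fin.last n
    · have : ¬(j = s ∧ l = s) := by omega
      rcases not_and_or.1 this with h | h <;> simp [_root_.resetLast, hi, h]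
    · simpa only [_root_.resetLast, if_neg hi] using hX.row i j l hjl
  · intro i h j hih
    have hi : i ≠ Fin.last n := (hih.trans_le (Fin.le_last h)).ne
    by_cases hh : h = Fin.last n
    · by_cases hj : j = s
      · simp [_root_.resetLast, hi, h0 i j hj.ge]
      · simp [_root_.resetLast, hh, hj]
    · simpa only [_root_.resetLast, if_neg hi, if_neg hh] using hX.col i h j hih
  · intro i h j l hih hjl
    have hi : i ≠ Fin.last n := (hih.trans_le (Fin.le_last h)).ne
    by_cases hh : h = Fin.last n
    · by_cases hj : j = s
      · simp [_root_.resetLast, hi, h0 i l (hj.ge.trans hjl.le)]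
      · simp [_root_.resetLast, hh, hj]
    · simpa only [_root_.resetLast, if_neg hi, if_neg hh] using hX.antidiag i h j l hih hjl
  · intro i h j l hih hjl
    have hi : i ≠ Fin.last n := (hih.trans_le (Fin.le_last h)).ne
    by_cases hh : h = Fin.last n
    · by_cases hl : l = s
      · simp [_root_.resetLast, hi, hh, hl, (hl ▸ hjl).ne]
      · by_cases hj : j = s
        · simp [_root_.resetLast, hi, hh, hl, h0 i l (hj.ge.trans hjl.le)]
        · simp [_root_.resetLast, hh, hj, hl]
    · simpa only [_root_.resetLast, if_neg hi, if_neg hh] using hX.diag i h j l hih hjl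

/-- A quantum matrix of operators assembled from the first `s` layers; its column `l` vanishes in
the rows before `r l`. -/
noncomputable def tower (q : k) (b : Bool) (r : ℕ → ℕ) :
    ℕ → Fin (n + 1) → ℕ → Module.End k (((Bool × ℕ) × Fin (n + 1) →₀ ℤ) →₀ k)
  | 0 => fun _ _ => 0
  | s + 1 => fun i l => ∑ d, layerMatrix q (b, s) (fun i : Fin (n + 1) => r s ≤ (i : ℕ)) i d *
      resetLast s (tower q b r s) d l

variable {q : k} {b : Bool} {r : ℕ → ℕ}

lemma tower_succ (s : ℕ) (i : Fin (n + 1)) (l : ℕ) : tower q b r (s + 1) i l =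
    ∑ d, layerMatrix q (b, s) (fun i : Fin (n + 1) => r s ≤ (i : ℕ)) i d *
      resetLast s (tower q b r s) d l := rfl

lemma tower_eq_zero_of_le (s : ℕ) (i : Fin (n + 1)) (l : ℕ) (h : s ≤ l) :
    tower q b r s i l = 0 := by
  induction s generalizing i l with
  | zero => rfl
  | succ s ih =>
    rw [tower_succ]
    refine Finset.sum_eq_zero fun d _ => ?_
    rw [resetLast, ih d l (by omega), if_neg (by omega : ¬ l = s), ite_self, mul_zero]

lemma tower_commute (hq : q ≠ 0) (c : Bool × ℕ) (i' j' : Fin (n + 1)) (s : ℕ)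
    (hc : c.1 ≠ b ∨ s ≤ c.2) (i : Fin (n + 1)) (l : ℕ) :
    Commute (tower q b r s i l) (layerOp q c i' j') := by
  induction s generalizing i l with
  | zero => exact Commute.zero_left _
  | succ s ih =>
    rw [tower_succ]
    refine Commute.sum_left _ _ _ fun d _ => Commute.mul_left ?_ ?_
    · rw [layerMatrix]
      split_ifs
      · refine layerOp_commute hq ?_ _ _ _ _
        rintro rfl
        rcases hc with hc | hc
        · exact hc rfl
        · exact absurd hc (by simp)
      · exact Commute.zero_left _
    · rw [resetLast]
      split_ifs
      · exact Commute.one_left _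
      · exact Commute.zero_left _
      · exact ih (hc.imp id (by omega)) d l

lemma tower_commute_tower (hq : q ≠ 0) {b' : Bool} {r' : ℕ → ℕ} (hb : b' ≠ b) (s s' : ℕ)
    (i i' : Fin (n + 1)) (l l' : ℕ) :
    Commute (tower q b r s i l) (tower q b' r' s' i' l') := by
  induction s' generalizing i' l' with
  | zero => exact Commute.zero_right _
  | succ s' ih =>
    rw [tower_succ]
    refine Commute.sum_right _ _ _ fun d _ => Commute.mul_right ?_ ?_
    · rw [layerMatrix]
      split_ifs
      · exact tower_commute hq _ _ _ s (Or.inl hb) i l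
      · exact Commute.zero_right _
    · rw [resetLast]
      split_ifs
      · exact Commute.one_right _
      · exact Commute.zero_right _
      · exact ih d l'

lemma tower_isQMatrix (hq : q ≠ 0) (s : ℕ) :
    IsQMatrix q (tower (n := n) q b r s) := by
  induction s with
  | zero => constructor <;> intros <;> simp [tower]
  | succ s ih =>
    have hN : IsQMatrix q (layerMatrix q (b, s) fun i : Fin (n + 1) => r s ≤ (i : ℕ)) :=
      layerMatrix_isQMatrix hq _ fun i j hij h => le_trans h hij
    have hY : IsQMatrix q (resetLast s (tower (n := n) q b r s)) :=
      ih.resetLast fun i l h => tower_eq_zero_of_le s i l h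
    refine IsQMatrix.mul (B := Module.End k (((Bool × ℕ) × Fin (n + 1) →₀ ℤ) →₀ k)) hq hN hY
      fun i a d j => ?_
    rw [resetLast, layerMatrix]
    split_ifs
    any_goals simp
    exact tower_commute hq _ _ _ s (Or.inr le_rfl) _ _

lemma tower_eq_zero_of_lt (hr : Monotone r) (s : ℕ) {i : Fin (n + 1)} (hi : i ≠ Fin.last n)
    (l : ℕ) (h : (i : ℕ) < r l) : tower q b r s i l = 0 := by
  induction s with
  | zero => rfl
  | succ s ih =>
    rw [tower_succ]
    refine Finset.sum_eq_zero fun d _ => ?_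
    rw [resetLast]
    split_ifs with hd hl
    · rw [layerMatrix_eq_zero, zero_mul]
      rintro (h' | h')
      · exact hi (h'.trans hd)
      · subst hl
        exact absurd h'.2 (not_le.2 h)
    · rw [mul_zero]
    · by_cases hid : i = d
      · subst hid
        rw [ih, mul_zero]
      · rcases le_or_gt s l with hsl | hsl
        · rw [tower_eq_zero_of_le s d l hsl, mul_zero]
        · rw [layerMatrix_eq_zero, zero_mul]
          rintro (h' | h')
          · exact hid h'
          · exact absurd (h'.2.trans_lt h) (not_lt.2 (hr hsl.le))

/-- The weight used to compare the monomials occurring in `tower`. -/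
noncomputable def towerWeight (n : ℕ) : ((Bool × ℕ) × Fin (n + 1) →₀ ℤ) →+ ℤ :=
  linForm fun ω => ((ω.2 : ℕ) - n : ℤ) * ((ω.1.2 : ℤ) + 1)

lemma towerWeight_unitVec_sub (b : Bool) (l : ℕ) (i j : Fin (n + 1)) :
    towerWeight n (unitVec (b, l) i - unitVec (b, l) j) =
      (((i : ℕ) : ℤ) - (j : ℕ)) * ((l : ℤ) + 1) := by
  simp only [towerWeight, unitVec, map_sub, linForm_single]
  ring

lemma tower_hasLead (hq : q ≠ 0) (hr : Monotone r) (s : ℕ) {i : Fin (n + 1)}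
    (hi : i ≠ Fin.last n) (l : ℕ) (hl : l < s) (h : r l ≤ (i : ℕ)) :
    HasLead (towerWeight n) (unitVec (b, l) i - unitVec (b, l) (Fin.last n))
      (tower q b r s i l) := by
  induction s generalizing i with
  | zero => exact absurd hl (Nat.not_lt_zero _)
  | succ s ih =>
    rw [tower_succ]
    rcases (Nat.lt_succ_iff.1 hl).eq_or_lt with rfl | hls
    · rw [Finset.sum_eq_single (Fin.last n)]
      · rw [resetLast, if_pos rfl, if_pos rfl, mul_one,
          layerMatrix_of _ (Or.inr ⟨Fin.lt_last_iff_ne_last.2 hi, h⟩)]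
        exact layerOp_hasLead hq _ _ _ _
      · intro d _ hd
        rw [resetLast, if_neg hd, tower_eq_zero_of_le l d l le_rfl, mul_zero]
      · simp
    · rw [← Finset.add_sum_erase _ _ (Finset.mem_univ i)]
      refine HasLead.add_lower ?_ (RaisesAtMost.sum fun d hd => ?_)
      · rw [resetLast, if_neg hi, layerMatrix_of _ (Or.inl rfl)]
        simpa using (layerOp_hasLead hq (towerWeight n) (b, s) i i).mul (ih hi hls h)
      · rw [resetLast, layerMatrix]
        split_ifs with h1 h2 h3
        · exact absurd h3 hls.ne
        · rw [mul_zero]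
          exact .zero
        · have hid : i < d := (h1.resolve_left (Finset.ne_of_mem_erase hd).symm).1
          have := (layerOp_hasLead hq (towerWeight n) (b, s) i d).raisesAtMost.mul
            (ih h2 hls (h.trans hid.le)).raisesAtMost
          refine this.mono ?_
          simp only [towerWeight_unitVec_sub]
          have h4 : (0 : ℤ) < (d : ℕ) - (i : ℕ) := by
            have : (i : ℕ) < d := hid
            omega
          have h5 : (0 : ℤ) < s - l := by omega
          nlinarith [mul_pos h4 h5]
        all_goals
          rw [zero_mul]
          exact .zero

lemma tower_raisesAtMost (hq : q ≠ 0) (hr : Monotone r) (s : ℕ) {i : Fin (n + 1)}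
    (hi : i ≠ Fin.last n) (l : ℕ) :
    RaisesAtMost (towerWeight n) (((i : ℕ) - n : ℤ) * ((l : ℤ) + 1)) (tower q b r s i l) := by
  rcases le_or_gt s l with hl | hl
  · rw [tower_eq_zero_of_le s i l hl]
    exact .zero
  rcases lt_or_ge (i : ℕ) (r l) with h | h
  · rw [tower_eq_zero_of_lt hr s hi l h]
    exact .zero
  · have := (tower_hasLead (b := b) hq hr s hi l hl h).raisesAtMost
    rwa [towerWeight_unitVec_sub, Fin.val_last] at this

end Tower

section PermExpansion

/-- The permutation sending `0` to `p` and `s + 1` to `p.succAbove (σ s)`. -/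
def permCons {t : ℕ} (p : Fin (t + 1)) (σ : Equiv.Perm (Fin t)) : Equiv.Perm (Fin (t + 1)) :=
  p.cycleRange.symm * Equiv.Perm.decomposeFin.symm (0, σ)

@[simp]
lemma permCons_zero {t : ℕ} (p : Fin (t + 1)) (σ : Equiv.Perm (Fin t)) :
    permCons p σ 0 = p := by
  simp [permCons]

@[simp]
lemma permCons_succ {t : ℕ} (p : Fin (t + 1)) (σ : Equiv.Perm (Fin t)) (s : Fin t) :
    permCons p σ s.succ = p.succAbove (σ s) := by
  simp [permCons, Fin.cycleRange_symm_succ]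

lemma permCons_bijective (t : ℕ) :
    Function.Bijective fun x : Fin (t + 1) × Equiv.Perm (Fin t) => permCons x.1 x.2 := by
  rw [Fintype.bijective_iff_injective_and_card]
  refine ⟨?_, by simp [Fintype.card_perm, Nat.factorial_succ]⟩
  rintro ⟨p, σ⟩ ⟨p', σ'⟩ h
  have h0 : p = p' := by simpa using DFunLike.congr_fun h 0
  subst h0
  have h1 : σ = σ' := Equiv.ext fun s => by
    have h1 := DFunLike.congr_fun h s.succ
    dsimp only at h1
    rw [permCons_succ, permCons_succ] at h1
    exact Fin.succAbove_right_injective h1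
  rw [h1]

lemma Fin.sum_succAbove_lt {t : ℕ} (p : Fin (t + 1)) :
    (∑ s : Fin t, if p.succAbove s < p then 1 else 0) = (p : ℕ) := by
  have h := Fin.sum_univ_succAbove (fun x : Fin (t + 1) => if x < p then 1 else 0) p
  rw [if_neg (lt_irrefl _), zero_add] at h
  rw [← h, ← Finset.card_filter]
  simp [Finset.filter_gt_eq_Iio]

lemma permLength_permCons {t : ℕ} (p : Fin (t + 1)) (σ : Equiv.Perm (Fin t)) :
    permLength (permCons p σ) = p + permLength σ := by
  have h : ∀ {u : ℕ} (τ : Equiv.Perm (Fin u)), permLength τ =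
      ∑ a : Fin u, ∑ b : Fin u, if a < b ∧ τ b < τ a then 1 else 0 := fun τ => by
    rw [permLength, Finset.card_filter, Fintype.sum_prod_type]
  rw [h, h, Fin.sum_univ_succ, Fin.sum_univ_succ]
  simp only [Fin.sum_univ_succ (n := t) (f := fun b => ite _ _ _), lt_irrefl, false_and, if_false,
    Fin.succ_pos, true_and, permCons_zero, permCons_succ, zero_add, Fin.not_lt_zero,
    Fin.succ_lt_succ_iff, (Fin.strictMono_succAbove p).lt_iff_lt]
  congr 1
  rw [Equiv.sum_comp σ fun s => if p.succAbove s < p then 1 else 0, Fin.sum_succAbove_lt]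

variable {k : Type*} [Field k] {ι κ : Type*} [LinearOrder ι] [LinearOrder κ]
  {B : Type*} [Ring B] [Algebra k B]

lemma minor_map_map (q : k) (X : ι → κ → B) {t : ℕ} (I : Fin t ↪o ι) (J : Fin t ↪o κ) :
    minor q X (Finset.univ.map I.toEmbedding) (Finset.univ.map J.toEmbedding) =
      ∑ σ : Equiv.Perm (Fin t),
        (-q) ^ permLength σ • (List.ofFn fun s => X (I s) (J (σ s))).prod := by
  induction t with
  | zero => simp [minor_empty_left, permLength]
  | succ t ih =>
    have hI : Finset.univ.map I.toEmbedding = insert (I 0)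
        (Finset.univ.map ((Fin.succOrderEmb t).trans I).toEmbedding) := by
      ext x
      simp [Fin.exists_fin_succ, eq_comm]
    rw [hI, minor_insert_left q X (by simp), Finset.sum_map,
      ← (permCons_bijective t).sum_comp (fun σ : Equiv.Perm (Fin (t + 1)) =>
        (-q) ^ permLength σ • (List.ofFn fun s => X (I s) (J (σ s))).prod),
      Fintype.sum_prod_type]
    refine Finset.sum_congr rfl fun p _ => ?_
    have hJ : (Finset.univ.map J.toEmbedding).erase (J p) =
        Finset.univ.map ((Fin.succAboveOrderEmb p).trans J).toEmbedding := by
      rw [← RelEmbedding.coe_toEmbedding, ← Finset.map_erase]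
      ext x
      simp only [Finset.mem_map, Finset.mem_erase, Finset.mem_univ, and_true, true_and,
        ← Fin.exists_succAbove_eq_iff]
      constructor
      · rintro ⟨_, ⟨s, rfl⟩, rfl⟩
        exact ⟨s, rfl⟩
      · rintro ⟨s, rfl⟩
        exact ⟨_, ⟨s, rfl⟩, rfl⟩
    have hc : crossings {J p} ((Finset.univ.map J.toEmbedding).erase (J p)) = p := by
      rw [hJ, crossings, Finset.sum_singleton, Finset.sum_map, ← Fin.sum_succAbove_lt]
      exact Finset.sum_congr rfl fun s _ => by simp
    simp only [RelEmbedding.coe_toEmbedding]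
    rw [hc, hJ, ih, Finset.mul_sum, Finset.smul_sum]
    refine Finset.sum_congr rfl fun σ _ => ?_
    rw [mul_smul_comm, smul_smul, ← pow_add, permLength_permCons, List.ofFn_succ, List.prod_cons]
    simp

end PermExpansion

section TowerMinors

lemma Fin.val_le_of_strictMono {t : ℕ} {f : Fin t → ℕ} (hf : StrictMono f) (s : Fin t) :
    (s : ℕ) ≤ f s := by
  obtain ⟨s, hs⟩ := s
  induction s with
  | zero => exact Nat.zero_le _
  | succ s ih => exact (ih (by omega)).trans_lt (hf (Fin.mk_lt_mk.2 (Nat.lt_succ_self s)))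

lemma Equiv.Perm.eq_one_of_le {t : ℕ} (σ : Equiv.Perm (Fin t))
    (h : ∀ a b, σ a < σ b → a ≤ b) : σ = 1 := by
  have hmono : StrictMono σ.symm := fun a b hab =>
    lt_of_le_of_ne (h _ _ (by simpa using hab)) fun he => hab.ne (σ.symm.injective he)
  have := Subsingleton.elim (hmono.orderIsoOfSurjective _ σ.symm.surjective) (OrderIso.refl _)
  ext a
  have h1 : σ.symm (σ a) = σ a := DFunLike.congr_fun this (σ a)
  rw [σ.symm_apply_apply] at h1
  exact congrArg Fin.val h1.symm

/-- The rearrangement inequality for negative increasing sequences. -/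
lemma sum_mul_perm_lt {t : ℕ} {x : Fin t → ℤ} (hx : StrictMono x) (hneg : ∀ s, x s < 0)
    {f : Fin t → ℕ} (hf : StrictMono f) (σ : Equiv.Perm (Fin t))
    (h : ¬ (σ = 1 ∧ ∀ s, f s = s)) :
    ∑ s, x s * ((f (σ s) : ℤ) + 1) < ∑ s, x s * (((s : ℕ) : ℤ) + 1) := by
  have hg : StrictMono fun s => (f s : ℤ) + 1 := fun a b hab => by
    have := hf hab
    dsimp only
    omega
  have hmono : Monovary x fun s => (f s : ℤ) + 1 := hx.monotone.monovary hg.monotone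
  have hle : ∀ s, x s * ((f s : ℤ) + 1) ≤ x s * (((s : ℕ) : ℤ) + 1) := fun s =>
    mul_le_mul_of_nonpos_left (by have := Fin.val_le_of_strictMono hf s; omega) (hneg s).le
  by_cases hσ : σ = 1
  · subst hσ
    have : ∃ s, f s ≠ s := by
      by_contra! hcon
      exact h ⟨rfl, hcon⟩
    obtain ⟨s, hs⟩ := this
    refine Finset.sum_lt_sum (fun s _ => hle s) ⟨s, Finset.mem_univ s, ?_⟩
    have := Fin.val_le_of_strictMono hf s
    exact mul_lt_mul_of_neg_left (by rw [Equiv.Perm.one_apply]; omega) (hneg s)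
  · refine lt_of_lt_of_le ?_ (Finset.sum_le_sum fun s _ => hle s)
    refine hmono.sum_mul_comp_perm_lt_sum_mul_iff.2 fun hcon =>
      hσ (σ.eq_one_of_le fun a b hab => ?_)
    exact hx.le_iff_le.1 (hcon (hg hab))

variable {k : Type*} [Field k] {n t t₀ : ℕ} {q : k} {b : Bool} {r : ℕ → ℕ}

/-- The leading exponent of the minor of a tower on the rows `I` and the first columns. -/
noncomputable def leadExp (b : Bool) (I : Fin t ↪o Fin (n + 1)) : (Bool × ℕ) × Fin (n + 1) →₀ ℤ :=
  ∑ s : Fin t, (unitVec (b, (s : ℕ)) (I s) - unitVec (b, (s : ℕ)) (Fin.last n))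

lemma towerWeight_leadExp (b : Bool) (I : Fin t ↪o Fin (n + 1)) :
    towerWeight n (leadExp b I) = ∑ s, (((I s : ℕ) : ℤ) - n) * (((s : ℕ) : ℤ) + 1) := by
  rw [leadExp, map_sum]
  exact Finset.sum_congr rfl fun s _ => by rw [towerWeight_unitVec_sub, Fin.val_last]

variable {I : Fin t ↪o Fin (n + 1)} {K : Fin t ↪o Fin t₀}

lemma tower_minor_eq_zero (hr : Monotone r) (hI : ∀ s, I s ≠ Fin.last n) (s : Fin t)
    (hs : (I s : ℕ) < r s) :
    minor q (fun i (l : Fin t₀) => tower q b r t₀ i l) (Finset.univ.map I.toEmbedding)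
      (Finset.univ.map K.toEmbedding) = 0 := by
  rw [minor_map_map]
  refine Finset.sum_eq_zero fun σ _ => ?_
  have : ∃ a ≤ s, s ≤ σ a := by
    by_contra! hcon
    have h1 : (Finset.Iic s).image σ ⊆ Finset.Iio s := fun x hx => by
      obtain ⟨a, ha, rfl⟩ := Finset.mem_image.1 hx
      exact Finset.mem_Iio.2 (hcon a (Finset.mem_Iic.1 ha))
    have h2 := Finset.card_le_card h1
    rw [Finset.card_image_of_injective _ σ.injective, Fin.card_Iic, Fin.card_Iio] at h2
    omega
  obtain ⟨a, has, hsa⟩ := this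
  rw [List.prod_eq_zero, smul_zero]
  rw [List.mem_ofFn]
  refine ⟨a, tower_eq_zero_of_lt hr _ (hI a) _ ?_⟩
  have hK : StrictMono fun u => (K u : ℕ) := fun u v huv => K.strictMono huv
  have h1 : (I a : ℕ) ≤ I s := I.monotone has
  have h2 : (s : ℕ) ≤ σ a := hsa
  exact (h1.trans_lt hs).trans_le (hr (h2.trans (Fin.val_le_of_strictMono hK (σ a))))

lemma tower_term_raisesAtMost (hq : q ≠ 0) (hr : Monotone r) (hI : ∀ s, I s ≠ Fin.last n)
    (σ : Equiv.Perm (Fin t)) :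
    RaisesAtMost (towerWeight n)
      (∑ s, (((I s : ℕ) : ℤ) - n) * (((K (σ s) : ℕ) : ℤ) + 1))
      (List.ofFn fun s => tower q b r t₀ (I s) (K (σ s))).prod := by
  rw [List.ofFn_eq_map, ← List.sum_ofFn, List.ofFn_eq_map]
  exact RaisesAtMost.prod _ fun s _ => tower_raisesAtMost hq hr _ (hI s) _

lemma sum_tower_weights_lt (hI : ∀ s, I s ≠ Fin.last n) (σ : Equiv.Perm (Fin t))
    (h : ¬ (σ = 1 ∧ ∀ s, (K s : ℕ) = s)) :
    ∑ s, (((I s : ℕ) : ℤ) - n) * (((K (σ s) : ℕ) : ℤ) + 1) ≤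
      towerWeight n (leadExp b I) - 1 := by
  rw [towerWeight_leadExp]
  refine Int.le_sub_one_of_lt (sum_mul_perm_lt (x := fun s => ((I s : ℕ) : ℤ) - n)
    (f := fun s => (K s : ℕ)) ?_ ?_ ?_ σ h)
  · intro u v huv
    have : (I u : ℕ) < I v := I.strictMono huv
    dsimp only
    omega
  · intro s
    have : (I s : ℕ) < n := Fin.val_lt_last (hI s)
    omega
  · exact fun u v huv => K.strictMono huv

lemma tower_minor_raisesAtMost (hq : q ≠ 0) (hr : Monotone r) (hI : ∀ s, I s ≠ Fin.last n)
    (hK : ¬ ∀ s, (K s : ℕ) = s) :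
    RaisesAtMost (towerWeight n) (towerWeight n (leadExp b I) - 1)
      (minor q (fun i (l : Fin t₀) => tower q b r t₀ i l) (Finset.univ.map I.toEmbedding)
        (Finset.univ.map K.toEmbedding)) := by
  rw [minor_map_map]
  exact RaisesAtMost.sum fun σ _ => ((tower_term_raisesAtMost hq hr hI σ).smul _).mono
    (sum_tower_weights_lt hI σ fun h => hK h.2)

lemma tower_minor_hasLead (hq : q ≠ 0) (hr : Monotone r) (hI : ∀ s, I s ≠ Fin.last n)
    (hK : ∀ s, (K s : ℕ) = s) (hIr : ∀ s : Fin t, r s ≤ (I s : ℕ)) :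
    HasLead (towerWeight n) (leadExp b I)
      (minor q (fun i (l : Fin t₀) => tower q b r t₀ i l) (Finset.univ.map I.toEmbedding)
        (Finset.univ.map K.toEmbedding)) := by
  rw [minor_map_map, ← Finset.add_sum_erase _ _ (Finset.mem_univ 1)]
  refine HasLead.add_lower (HasLead.smul ?_ (pow_ne_zero _ (neg_ne_zero.2 hq)))
    (RaisesAtMost.sum fun σ hσ => ((tower_term_raisesAtMost hq hr hI σ).smul _).mono
    (sum_tower_weights_lt hI σ fun h => Finset.ne_of_mem_erase hσ h.1))
  rw [leadExp, List.ofFn_eq_map, ← List.sum_ofFn, List.ofFn_eq_map]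
  refine HasLead.prod _ fun s _ => ?_
  rw [Equiv.Perm.one_apply, hK s]
  exact tower_hasLead hq hr _ (hI s) _ ((hK s) ▸ (K s).isLt) (hIr s)

end TowerMinors

section Representation

variable {k : Type*} [Field k] {m n : ℕ} {q : k}

/-- The entries of an increasing sequence, continued by the constant `n`. -/
def boundOf {t p : ℕ} (n : ℕ) (I : Fin t ↪o Fin p) (s : ℕ) : ℕ :=
  if h : s < t then (I ⟨s, h⟩ : ℕ) else n

lemma boundOf_monotone {t p n : ℕ} (hp : p ≤ n) (I : Fin t ↪o Fin p) : Monotone (boundOf n I) := by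
  intro a b hab
  rw [boundOf, boundOf]
  split_ifs with h1 h2 h2
  · exact I.monotone (Fin.mk_le_mk.2 hab)
  · exact ((I _).isLt.trans_le hp).le
  · omega
  · exact le_rfl

lemma boundOf_val {t p n : ℕ} (I : Fin t ↪o Fin p) (s : Fin t) : boundOf n I s = I s :=
  dif_pos s.isLt

/-- The rows of a `p`-row matrix as the rows other than the last among `n + 1` rows. -/
def rowEmb {p n : ℕ} (hp : p ≤ n) : Fin p ↪o Fin (n + 1) :=
  Fin.castLEOrderEmb (hp.trans n.le_succ)

lemma rowEmb_ne_last {p n : ℕ} (hp : p ≤ n) (i : Fin p) : rowEmb hp i ≠ Fin.last n := by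
  intro h
  have := congrArg Fin.val h
  have h2 : (rowEmb hp i : ℕ) = i := rfl
  rw [h2, Fin.val_last] at this
  omega

/-- The tower attached to an increasing sequence. -/
noncomputable def seqTower {t p : ℕ} (q : k) (b : Bool) (hp : p ≤ n) (I : Fin t ↪o Fin p)
    (i : Fin p) (l : Fin t) : Module.End k (((Bool × ℕ) × Fin (n + 1) →₀ ℤ) →₀ k) :=
  tower q b (boundOf n I) t (rowEmb hp i) l

lemma seqTower_isQMatrix {t p : ℕ} {b : Bool} (hq : q ≠ 0) (hp : p ≤ n) (I : Fin t ↪o Fin p) :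
    IsQMatrix q (seqTower q b hp I) :=
  IsQMatrix.submatrix (X := tower q b (boundOf n I) t) (tower_isQMatrix hq t)
    (rowEmb hp).strictMono Fin.val_strictMono

lemma seqTower_minor {t t' p : ℕ} (b : Bool) (hp : p ≤ n) (I : Fin t ↪o Fin p)
    (I' : Fin t' ↪o Fin p) (K : Fin t' ↪o Fin t) :
    minor q (seqTower q b hp I) (Finset.univ.map I'.toEmbedding) (Finset.univ.map K.toEmbedding) =
      minor q (fun i (l : Fin t) => tower q b (boundOf n I) t i l)
        (Finset.univ.map (I'.trans (rowEmb hp)).toEmbedding)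
        (Finset.univ.map K.toEmbedding) := by
  rw [minor_map_map, minor_map_map]
  rfl

lemma seqTower_minor_eq_zero {t t' p : ℕ} (b : Bool) (hp : p ≤ n) (I : Fin t ↪o Fin p)
    (I' : Fin t' ↪o Fin p) (K : Fin t' ↪o Fin t) (hle : t' ≤ t) (s : Fin t')
    (hs : I' s < I (Fin.castLE hle s)) :
    minor q (seqTower q b hp I) (Finset.univ.map I'.toEmbedding)
      (Finset.univ.map K.toEmbedding) = 0 := by
  rw [seqTower_minor]
  exact tower_minor_eq_zero (boundOf_monotone hp I) (fun s => rowEmb_ne_last hp (I' s)) s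
    (lt_of_lt_of_eq hs (boundOf_val I (Fin.castLE hle s)).symm)

lemma seqTower_minor_raisesAtMost {t t' p : ℕ} (hq : q ≠ 0) (b : Bool) (hp : p ≤ n)
    (I : Fin t ↪o Fin p) (I' : Fin t' ↪o Fin p) (K : Fin t' ↪o Fin t)
    (hK : ¬ ∀ s, (K s : ℕ) = s) :
    RaisesAtMost (towerWeight n) (towerWeight n (leadExp b (I'.trans (rowEmb hp))) - 1)
      (minor q (seqTower q b hp I) (Finset.univ.map I'.toEmbedding)
        (Finset.univ.map K.toEmbedding)) := by
  rw [seqTower_minor]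
  exact tower_minor_raisesAtMost hq (boundOf_monotone hp I)
    (fun s => rowEmb_ne_last hp (I' s)) hK

lemma seqTower_minor_hasLead {t t' p : ℕ} (hq : q ≠ 0) (b : Bool) (hp : p ≤ n)
    (I : Fin t ↪o Fin p) (I' : Fin t' ↪o Fin p) (hle : t' ≤ t)
    (hI : ∀ s, I (Fin.castLE hle s) ≤ I' s) :
    HasLead (towerWeight n) (leadExp b (I'.trans (rowEmb hp)))
      (minor q (seqTower q b hp I) (Finset.univ.map I'.toEmbedding)
        (Finset.univ.map (Fin.castLEOrderEmb hle).toEmbedding)) := by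
  rw [seqTower_minor]
  exact tower_minor_hasLead hq (boundOf_monotone hp I) (fun s => rowEmb_ne_last hp (I' s))
    (fun s => rfl) fun s => le_of_eq_of_le (boundOf_val I (Fin.castLE hle s)) (hI s)

lemma Finset.eq_map_orderEmbOfFin {κ : Type*} [LinearOrder κ] (K : Finset κ) {t : ℕ}
    (h : K.card = t) : K = Finset.univ.map (K.orderEmbOfFin h).toEmbedding := by
  rw [← Finset.coe_inj]
  simp

/-- The matrix of operators of the representation attached to an index pair. -/
noncomputable def repMatrix (q : k) (hmn : m ≤ n) (P : DeltaIdx m n) (i : Fin m) (j : Fin n) :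
    Module.End k (((Bool × ℕ) × Fin (n + 1) →₀ ℤ) →₀ k) :=
  ∑ l, seqTower q false hmn P.I i l * seqTower q true le_rfl P.J j l

lemma repMatrix_isQMatrix (hq : q ≠ 0) (hmn : m ≤ n) (P : DeltaIdx m n) :
    IsQMatrix q (repMatrix q hmn P) := by
  have hN : IsQMatrix q (seqTower q false hmn P.I) := seqTower_isQMatrix hq hmn P.I
  have hY : IsQMatrix q fun l j => seqTower q true le_rfl P.J j l :=
    IsQMatrix.transpose (seqTower_isQMatrix hq le_rfl P.J)
  exact IsQMatrix.mul (N := seqTower q false hmn P.I)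
    (Y := fun l j => seqTower q true le_rfl P.J j l) hq hN hY
    fun _ _ _ _ => tower_commute_tower hq (by simp) _ _ _ _ _ _

lemma repMatrix_minor (hq : q ≠ 0) (hmn : m ≤ n) (P : DeltaIdx m n) (I : Finset (Fin m))
    (J : Finset (Fin n)) :
    minor q (repMatrix q hmn P) I J = ∑ K : Finset (Fin P.t),
      minor q (seqTower q false hmn P.I) I K * minor q (seqTower q true le_rfl P.J) J K := by
  have h := minor_mul hq (seqTower_isQMatrix (b := true) hq le_rfl P.J).transpose
    (N := seqTower q false hmn P.I)
    (fun _ _ _ _ => tower_commute_tower hq (by simp) _ _ _ _ _ _) I J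
  refine h.trans (Finset.sum_congr rfl fun K _ => ?_)
  rw [minor_transpose (X := seqTower q true le_rfl P.J) (seqTower_isQMatrix hq le_rfl P.J)]

lemma repMatrix_minor_eq_zero (hq : q ≠ 0) (hmn : m ≤ n) {P Q : DeltaIdx m n} (h : ¬ P ≤ Q) :
    minor q (repMatrix q hmn P) (Finset.univ.map Q.I.toEmbedding)
      (Finset.univ.map Q.J.toEmbedding) = 0 := by
  rw [repMatrix_minor hq]
  refine Finset.sum_eq_zero fun K _ => ?_
  by_cases hK : K.card = Q.t
  · have hle : Q.t ≤ P.t := by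
      rw [← hK]
      exact (Finset.card_le_univ K).trans_eq (Fintype.card_fin _)
    rw [K.eq_map_orderEmbOfFin hK]
    have h2 : (∃ s : Fin Q.t, Q.I s < P.I (Fin.castLE hle s)) ∨
        ∃ s : Fin Q.t, Q.J s < P.J (Fin.castLE hle s) := by
      by_contra! hcon
      exact h ⟨hle, hcon⟩
    rcases h2 with ⟨s, hs⟩ | ⟨s, hs⟩
    · rw [seqTower_minor_eq_zero false hmn P.I Q.I _ hle s hs, zero_mul]
    · rw [seqTower_minor_eq_zero true le_rfl P.J Q.J _ hle s hs, mul_zero]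
  · rw [minor_eq_zero_of_card_ne, zero_mul]
    rw [Finset.card_map, Finset.card_univ, Fintype.card_fin]
    exact fun h => hK h.symm

/-- The leading exponent of a minor of `repMatrix`. -/
noncomputable def minorExp (hmn : m ≤ n) (Q : DeltaIdx m n) : (Bool × ℕ) × Fin (n + 1) →₀ ℤ :=
  leadExp false (Q.I.trans (rowEmb hmn)) + leadExp true (Q.J.trans (rowEmb le_rfl))

lemma repMatrix_minor_hasLead (hq : q ≠ 0) (hmn : m ≤ n) {P Q : DeltaIdx m n} (h : P ≤ Q) :
    HasLead (towerWeight n) (minorExp hmn Q)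
      (minor q (repMatrix q hmn P) (Finset.univ.map Q.I.toEmbedding)
        (Finset.univ.map Q.J.toEmbedding)) := by
  obtain ⟨hle, hI, hJ⟩ := h
  rw [repMatrix_minor hq, ← Finset.add_sum_erase _ _
    (Finset.mem_univ (Finset.univ.map (Fin.castLEOrderEmb hle).toEmbedding))]
  refine HasLead.add_lower ?_ (RaisesAtMost.sum fun K hK0 => ?_)
  · exact (seqTower_minor_hasLead hq false hmn P.I Q.I hle hI).mul
      (seqTower_minor_hasLead hq true le_rfl P.J Q.J hle hJ)
  · by_cases hK : K.card = Q.t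
    · have hne : ¬ ∀ s, (K.orderEmbOfFin hK s : ℕ) = s := fun hcon => by
        refine Finset.ne_of_mem_erase hK0 ?_
        rw [K.eq_map_orderEmbOfFin hK]
        congr 1
        ext s
        exact hcon s
      rw [K.eq_map_orderEmbOfFin hK]
      refine ((seqTower_minor_raisesAtMost hq false hmn P.I Q.I _ hne).mul
        (seqTower_minor_raisesAtMost hq true le_rfl P.J Q.J _ hne)).mono ?_
      rw [minorExp, map_add]
      omega
    · rw [minor_eq_zero_of_card_ne, zero_mul]
      · exact .zero
      · rw [Finset.card_map, Finset.card_univ, Fintype.card_fin]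
        exact fun h => hK h.symm

lemma leadExp_apply {t : ℕ} (b b' : Bool) (I : Fin t ↪o Fin (n + 1)) (s : ℕ) {x : Fin (n + 1)}
    (hx : x ≠ Fin.last n) :
    leadExp b I ((b', s), x) = if b = b' ∧ ∃ h : s < t, I ⟨s, h⟩ = x then 1 else 0 := by
  rw [leadExp, Finsupp.finsetSum_apply]
  have : ∀ u : Fin t, (unitVec (b, (u : ℕ)) (I u) - unitVec (b, (u : ℕ)) (Fin.last n))
      ((b', s), x) = if b = b' ∧ (u : ℕ) = s ∧ I u = x then 1 else 0 := fun u => by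
    have hne : ((b, (u : ℕ)), Fin.last n) ≠ ((b', s), x) := fun h => hx (congrArg Prod.snd h).symm
    rw [unitVec, unitVec, Finsupp.sub_apply, Finsupp.single_apply, Finsupp.single_apply,
      if_neg hne, sub_zero]
    simp only [Prod.mk.injEq, and_assoc]
  simp only [this]
  split_ifs with h
  · obtain ⟨hb, hs, hI⟩ := h
    rw [Finset.sum_eq_single ⟨s, hs⟩]
    · exact if_pos ⟨hb, rfl, hI⟩
    · intro u _ hu
      exact if_neg fun h => hu (Fin.ext h.2.1)
    · simp
  · refine Finset.sum_eq_zero fun u _ => if_neg fun h' => h ⟨h'.1, ?_⟩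
    obtain ⟨-, rfl, hI⟩ := h'
    exact ⟨u.isLt, hI⟩

lemma minorExp_apply_false (hmn : m ≤ n) (Q : DeltaIdx m n) (s : ℕ) (i : Fin m) :
    minorExp hmn Q ((false, s), rowEmb hmn i) = if ∃ h : s < Q.t, Q.I ⟨s, h⟩ = i then 1 else 0 := by
  rw [minorExp, Finsupp.add_apply, leadExp_apply _ _ _ _ (rowEmb_ne_last _ _),
    leadExp_apply _ _ _ _ (rowEmb_ne_last _ _)]
  simp

lemma minorExp_apply_true (hmn : m ≤ n) (Q : DeltaIdx m n) (s : ℕ) (j : Fin n) :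
    minorExp hmn Q ((true, s), rowEmb le_rfl j) =
      if ∃ h : s < Q.t, Q.J ⟨s, h⟩ = j then 1 else 0 := by
  rw [minorExp, Finsupp.add_apply, leadExp_apply _ _ _ _ (rowEmb_ne_last _ _),
    leadExp_apply _ _ _ _ (rowEmb_ne_last _ _)]
  simp

lemma exists_of_sum_ite_eq {α : Type*} (l l' : List α) (p : α → Prop) [DecidablePred p]
    (h : (l.map fun a => if p a then (1 : ℤ) else 0).sum =
      (l'.map fun a => if p a then (1 : ℤ) else 0).sum) {a : α} (ha : a ∈ l') (hp : p a) :
    ∃ a ∈ l, p a := by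
  have hsum : ∀ l : List α, (l.map fun a => if p a then (1 : ℤ) else 0).sum =
      (l.countP (p ·) : ℕ) := fun l => by
    induction l with
    | nil => rfl
    | cons a l ih =>
      rw [List.map_cons, List.sum_cons, ih, List.countP_cons]
      split_ifs <;> simp_all [add_comm]
  rw [hsum, hsum, Nat.cast_inj] at h
  have : 0 < l'.countP (p ·) := List.countP_pos_iff.2 ⟨a, ha, by simpa using hp⟩
  rw [← h, List.countP_pos_iff] at this
  simpa using this

lemma list_sum_apply {α Ω : Type*} (l : List α) (f : α → Ω →₀ ℤ) (ω : Ω) :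
    (l.map f).sum ω = (l.map fun a => f a ω).sum := by
  induction l with
  | nil => rfl
  | cons a l ih => simp [ih]

lemma le_of_sum_minorExp_eq (hmn : m ≤ n) {P Q : DeltaIdx m n} {l l' : List (DeltaIdx m n)}
    (hl : ∀ R ∈ l, P ≤ R)
    (h : (l.map (minorExp hmn)).sum = (l'.map (minorExp hmn)).sum) (hQ : Q ∈ l') : P ≤ Q := by
  have hI : ∀ s : Fin Q.t, ∃ hs : (s : ℕ) < P.t, P.I ⟨s, hs⟩ ≤ Q.I s := fun s => by
    have h1 := DFunLike.congr_fun h ((false, (s : ℕ)), rowEmb hmn (Q.I s))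
    simp only [list_sum_apply, minorExp_apply_false] at h1
    obtain ⟨R, hR, hs, hRI⟩ := exists_of_sum_ite_eq _ _ _ h1 hQ ⟨s.isLt, rfl⟩
    obtain ⟨ht, hPI, -⟩ := hl R hR
    exact ⟨hs.trans_le ht, (hPI ⟨s, hs⟩).trans_eq hRI⟩
  have hJ : ∀ s : Fin Q.t, ∃ hs : (s : ℕ) < P.t, P.J ⟨s, hs⟩ ≤ Q.J s := fun s => by
    have h1 := DFunLike.congr_fun h ((true, (s : ℕ)), rowEmb le_rfl (Q.J s))
    simp only [list_sum_apply, minorExp_apply_true] at h1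
    obtain ⟨R, hR, hs, hRJ⟩ := exists_of_sum_ite_eq _ _ _ h1 hQ ⟨s.isLt, rfl⟩
    obtain ⟨ht, -, hPJ⟩ := hl R hR
    exact ⟨hs.trans_le ht, (hPJ ⟨s, hs⟩).trans_eq hRJ⟩
  have ht : Q.t ≤ P.t := by
    obtain ⟨hs, -⟩ := hI ⟨Q.t - 1, Nat.sub_lt Q.t_pos one_pos⟩
    have := Q.t_pos
    dsimp only at hs
    omega
  exact ⟨ht, fun s => (hI s).2, fun s => (hJ s).2⟩

lemma sum_minorExp_injective (hmn : m ≤ n) {l l' : List (DeltaIdx m n)}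
    (hl : l.IsChain (· ≤ ·)) (hl' : l'.IsChain (· ≤ ·))
    (h : (l.map (minorExp hmn)).sum = (l'.map (minorExp hmn)).sum) : l = l' := by
  have hnil : ∀ (Q : DeltaIdx m n) (l : List (DeltaIdx m n)),
      0 ≠ ((Q :: l).map (minorExp hmn)).sum := fun Q l h => by
    have h1 := DFunLike.congr_fun h ((false, 0), rowEmb hmn (Q.I ⟨0, Q.t_pos⟩))
    simp only [list_sum_apply, minorExp_apply_false] at h1
    obtain ⟨R, hR, -⟩ := exists_of_sum_ite_eq [] _ _ h1 List.mem_cons_self ⟨Q.t_pos, rfl⟩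
    simp at hR
  induction l generalizing l' with
  | nil =>
    cases l' with
    | nil => rfl
    | cons Q l' => exact (hnil Q l' h).elim
  | cons P l ih =>
    cases l' with
    | nil => exact (hnil P l h.symm).elim
    | cons Q l' =>
      have hmem : ∀ {R : DeltaIdx m n} {l : List (DeltaIdx m n)}, (R :: l).IsChain (· ≤ ·) →
          ∀ S ∈ R :: l, R ≤ S := fun hc S hS => by
        rcases List.mem_cons.1 hS with rfl | hS
        · exact le_rfl
        · exact (List.pairwise_cons.1 hc.pairwise).1 S hS
      have hPQ : P = Q := le_antisymm
        (le_of_sum_minorExp_eq hmn (hmem hl) h List.mem_cons_self)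
        (le_of_sum_minorExp_eq hmn (hmem hl') h.symm List.mem_cons_self)
      subst hPQ
      simp only [List.map_cons, List.sum_cons, add_right_inj] at h
      rw [ih hl.tail (l' := l') hl'.tail h]

end Representation

section QuantumMatrixAlgebra

variable {k : Type*} [Field k] {q : k} (hq : q ≠ 0) {m n : ℕ}

lemma qX_isQMatrix :
    IsQMatrix q fun (i : Fin m) (j : Fin n) => qX k (Units.mk0 q hq) i j where
  row i j l h := by
    simpa [qX] using RingQuot.mkAlgHom_rel k (qMatrixRel.row (u := Units.mk0 q hq) i j l h)
  col i h j hi := by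
    simpa [qX] using RingQuot.mkAlgHom_rel k (qMatrixRel.col (u := Units.mk0 q hq) i h j hi)
  antidiag i h j l hi hj := by
    simpa [qX] using
      RingQuot.mkAlgHom_rel k (qMatrixRel.antidiag (u := Units.mk0 q hq) h i j l hi hj)
  diag i h j l hi hj := by
    simpa [qX] using
      RingQuot.mkAlgHom_rel k (qMatrixRel.diag (u := Units.mk0 q hq) i h j l hi hj)

variable {hq} in
/-- The universal property of the algebra of quantum matrices. -/
noncomputable def IsQMatrix.lift {B : Type*} [Semiring B] [Algebra k B] {X : Fin m → Fin n → B}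
    (hX : IsQMatrix q X) : QuantumMat k (Units.mk0 q hq) m n →ₐ[k] B :=
  RingQuot.liftAlgHom k ⟨FreeAlgebra.lift k fun x : Fin m × Fin n => X x.1 x.2, by
    intro x y h
    induction h with
    | row i j l h => simpa using hX.row i j l h
    | col i h j hi => simpa using hX.col i h j hi
    | antidiag i h j l hi hj => simpa using hX.antidiag h i j l hi hj
    | diag i h j l hi hj => simpa using hX.diag i h j l hi hj⟩

variable {hq} in
@[simp]
lemma IsQMatrix.lift_qX {B : Type*} [Semiring B] [Algebra k B] {X : Fin m → Fin n → B}
    (hX : IsQMatrix q X) (i : Fin m) (j : Fin n) :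
    hX.lift (qX k (Units.mk0 q hq) i j) = X i j := by
  rw [IsQMatrix.lift, qX, RingQuot.liftAlgHom_mkAlgHom_apply, FreeAlgebra.lift_ι_apply]

variable {hq} in
lemma quantumMat_hom_ext {B : Type*} [Semiring B] [Algebra k B]
    {f g : QuantumMat k (Units.mk0 q hq) m n →ₐ[k] B}
    (h : ∀ i j, f (qX k (Units.mk0 q hq) i j) = g (qX k (Units.mk0 q hq) i j)) : f = g := by
  refine RingQuot.ringQuot_ext' _ _ _ (FreeAlgebra.hom_ext (funext fun x => ?_))
  exact h x.1 x.2

lemma qMinor_eq_minor (P : DeltaIdx m n) :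
    qMinor k (Units.mk0 q hq) P = minor q (fun i j => qX k (Units.mk0 q hq) i j)
      (Finset.univ.map P.I.toEmbedding) (Finset.univ.map P.J.toEmbedding) := by
  rw [minor_map_map]
  rfl

variable {hq} in
lemma IsQMatrix.lift_qMinor {B : Type*} [Ring B] [Algebra k B] {X : Fin m → Fin n → B}
    (hX : IsQMatrix q X) (P : DeltaIdx m n) :
    hX.lift (qMinor k (Units.mk0 q hq) P) =
      minor q X (Finset.univ.map P.I.toEmbedding) (Finset.univ.map P.J.toEmbedding) := by
  rw [minor_map_map, qMinor, map_sum]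
  refine Finset.sum_congr rfl fun σ _ => ?_
  rw [map_smul, map_list_prod, List.map_ofFn]
  congr 3
  ext s
  simp

/-- The span of the generators of the algebra of quantum matrices. -/
def qXSpan (k : Type*) [Field k] {q : k} (hq : q ≠ 0) (m n : ℕ) :
    Submodule k (QuantumMat k (Units.mk0 q hq) m n) :=
  Submodule.span k (Set.range fun x : Fin m × Fin n => qX k (Units.mk0 q hq) x.1 x.2)

lemma qX_mem_qXSpan (i : Fin m) (j : Fin n) : qX k (Units.mk0 q hq) i j ∈ qXSpan k hq m n :=
  Submodule.subset_span ⟨(i, j), rfl⟩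

/-- The generators as elements of degree one in the external direct sum. -/
noncomputable def gradedX (i : Fin m) (j : Fin n) :
    DirectSum ℕ fun d => ↥(qXSpan k hq m n ^ d) :=
  DirectSum.lof k ℕ (fun d => ↥(qXSpan k hq m n ^ d)) 1
    ⟨qX k (Units.mk0 q hq) i j, by simpa only [pow_one] using qX_mem_qXSpan hq i j⟩

lemma gradedX_mul (i h : Fin m) (j l : Fin n) :
    ∃ hmem : qX k (Units.mk0 q hq) i j * qX k (Units.mk0 q hq) h l ∈ qXSpan k hq m n ^ (1 + 1),
    gradedX hq i j * gradedX hq h l =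
      DirectSum.lof k ℕ (fun d => ↥(qXSpan k hq m n ^ d)) (1 + 1) ⟨_, hmem⟩ :=
  ⟨_, DirectSum.of_mul_of _ _⟩

lemma gradedX_isQMatrix : IsQMatrix q (gradedX (k := k) (m := m) (n := n) hq) where
  row i j l h := by
    obtain ⟨h1, e1⟩ := gradedX_mul hq i i j l
    obtain ⟨h2, e2⟩ := gradedX_mul hq i i l j
    rw [e1, e2, ← map_smul]
    exact congrArg _ (Subtype.ext ((qX_isQMatrix hq).row i j l h))
  col i h j hi := by
    obtain ⟨h1, e1⟩ := gradedX_mul hq i h j j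
    obtain ⟨h2, e2⟩ := gradedX_mul hq h i j j
    rw [e1, e2, ← map_smul]
    exact congrArg _ (Subtype.ext ((qX_isQMatrix hq).col i h j hi))
  antidiag i h j l hi hj := by
    obtain ⟨h1, e1⟩ := gradedX_mul hq h i j l
    obtain ⟨h2, e2⟩ := gradedX_mul hq i h l j
    rw [e1, e2]
    exact congrArg _ (Subtype.ext ((qX_isQMatrix hq).antidiag i h j l hi hj))
  diag i h j l hi hj := by
    obtain ⟨h1, e1⟩ := gradedX_mul hq i h j l
    obtain ⟨h2, e2⟩ := gradedX_mul hq h i l j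
    obtain ⟨h3, e3⟩ := gradedX_mul hq i h l j
    rw [e1, e2, e3, ← map_smul, ← map_add]
    exact congrArg _ (Subtype.ext ((qX_isQMatrix hq).diag i h j l hi hj))

/-- The grading of the algebra of quantum matrices by the powers of the span of the generators. -/
@[reducible]
noncomputable def quantumMatGradedAlgebra : GradedAlgebra (qXSpan k hq m n ^ · : ℕ → _) :=
  GradedAlgebra.ofAlgHom _ (gradedX_isQMatrix hq).lift
    (by
      refine quantumMat_hom_ext fun i j => ?_
      rw [AlgHom.comp_apply, IsQMatrix.lift_qX, gradedX]
      exact DirectSum.coeAlgHom_of _ _ _)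
    fun d x => by
      obtain ⟨x, hx⟩ := x
      dsimp only
      induction hx using Submodule.pow_induction_on_left' with
      | algebraMap r =>
        rw [AlgHom.commutes, DirectSum.algebraMap_apply]
        rfl
      | add x y i hx hy ihx ihy =>
        rw [map_add, ihx, ihy, ← map_add]
        rfl
      | mem_mul a ha d x hx ih =>
        rw [map_mul, ih]
        have : (gradedX_isQMatrix hq).lift a = DirectSum.of (fun d => ↥(qXSpan k hq m n ^ d)) 1
            ⟨a, by simpa only [pow_one] using ha⟩ := by
          induction ha using Submodule.span_induction with
          | mem a ha =>
            obtain ⟨x, rfl⟩ := ha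
            exact (gradedX_isQMatrix hq).lift_qX _ _
          | zero =>
            rw [map_zero]
            exact (map_zero (DirectSum.of (fun d => ↥(qXSpan k hq m n ^ d)) 1)).symm
          | add a b _ _ iha ihb =>
            rw [map_add, iha, ihb, ← map_add]
            rfl
          | smul c a _ iha =>
            rw [map_smul, iha, ← DirectSum.lof_eq_of k, ← map_smul]
            rfl
        rw [this, DirectSum.of_mul_of]
        exact DirectSum.of_eq_of_gradedMonoid_eq (Sigma.subtype_ext (add_comm _ _) rfl)

lemma qMinor_mem_pow (P : DeltaIdx m n) :
    qMinor k (Units.mk0 q hq) P ∈ qXSpan k hq m n ^ P.t := by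
  refine Submodule.sum_mem _ fun σ _ => Submodule.smul_mem _ _ ?_
  have : ∀ l : List (QuantumMat k (Units.mk0 q hq) m n), (∀ x ∈ l, x ∈ qXSpan k hq m n) →
      l.prod ∈ qXSpan k hq m n ^ l.length := fun l => by
    induction l with
    | nil => 
      intro _
      rw [List.prod_nil, List.length_nil, pow_zero]
      exact Submodule.one_le.1 le_rfl
    | cons a l ih =>
      intro h
      rw [List.prod_cons, List.length_cons, pow_succ']
      exact Submodule.mul_mem_mul (h a List.mem_cons_self)
        (ih fun x hx => h x (List.mem_cons_of_mem _ hx))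
  have h := this (List.ofFn fun s => qX k (Units.mk0 q hq) (P.I s) (P.J (σ s))) fun x hx => by
    obtain ⟨s, rfl⟩ := (List.mem_ofFn ..).1 hx
    exact qX_mem_qXSpan hq _ _
  rwa [List.length_ofFn] at h

/-- The index pair of a single entry. -/
def DeltaIdx.entry (hm : 0 < m) (i : Fin m) (j : Fin n) : DeltaIdx m n where
  t := 1
  t_pos := one_pos
  t_le := hm
  I := OrderEmbedding.ofStrictMono (fun _ => i) (Subsingleton.strictMono _)
  J := OrderEmbedding.ofStrictMono (fun _ => j) (Subsingleton.strictMono _)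

lemma qMinor_entry (hm : 0 < m) (i : Fin m) (j : Fin n) :
    qMinor k (Units.mk0 q hq) (DeltaIdx.entry hm i j) = qX k (Units.mk0 q hq) i j := by
  have h1 : Finset.univ.map (DeltaIdx.entry hm i j).I.toEmbedding = {i} :=
    Finset.eq_singleton_iff_unique_mem.2 ⟨by simpa using ⟨⟨0, one_pos⟩, rfl⟩, fun x hx => by
      obtain ⟨s, -, rfl⟩ := Finset.mem_map.1 hx
      rfl⟩
  have h2 : Finset.univ.map (DeltaIdx.entry hm i j).J.toEmbedding = {j} :=
    Finset.eq_singleton_iff_unique_mem.2 ⟨by simpa using ⟨⟨0, one_pos⟩, rfl⟩, fun x hx => by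
      obtain ⟨s, -, rfl⟩ := Finset.mem_map.1 hx
      rfl⟩
  rw [qMinor_eq_minor, h1, h2, minor_singleton]

lemma adjoin_range_qMinor (hm : 0 < m) :
    Algebra.adjoin k (Set.range fun P : DeltaIdx m n => qMinor k (Units.mk0 q hq) P) = ⊤ := by
  set S := Algebra.adjoin k (Set.range fun P : DeltaIdx m n => qMinor k (Units.mk0 q hq) P)
  have hmem : ∀ i j, qX k (Units.mk0 q hq) i j ∈ S := fun i j =>
    qMinor_entry hq hm i j ▸ Algebra.subset_adjoin ⟨DeltaIdx.entry hm i j, rfl⟩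
  have hX : IsQMatrix q fun (i : Fin m) (j : Fin n) => (⟨_, hmem i j⟩ : S) := by
    have h := qX_isQMatrix (m := m) (n := n) hq
    exact ⟨fun i j l hj => Subtype.ext (h.row i j l hj),
      fun i h' j hi => Subtype.ext (h.col i h' j hi),
      fun i h' j l hi hj => Subtype.ext (h.antidiag i h' j l hi hj),
      fun i h' j l hi hj => Subtype.ext (h.diag i h' j l hi hj)⟩
  have hid : S.val.comp hX.lift = AlgHom.id k _ := quantumMat_hom_ext fun i j => by simp
  refine eq_top_iff.2 fun x _ => ?_
  have := DFunLike.congr_fun hid x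
  rw [AlgHom.id_apply] at this
  rw [← this]
  exact (hX.lift x).2

end QuantumMatrixAlgebra

lemma exists_le_of_isStdPair {ι : Type*} [LinearOrder ι] {t t' : ℕ} {f : Fin t ↪o ι}
    {g : Fin t' ↪o ι}
    (h : IsStdPair (Finset.univ.map f.toEmbedding) (Finset.univ.map g.toEmbedding)) :
    ∃ hle : t' ≤ t, ∀ s, f (Fin.castLE hle s) ≤ g s := by
  have hcard : ∀ s : Fin t', (s : ℕ) + 1 ≤ (Finset.univ.filter fun r => f r ≤ g s).card := by
    intro s
    have h1 := h (g s)
    rw [Finset.filter_map, Finset.card_map, Finset.filter_map, Finset.card_map] at h1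
    refine le_trans (le_of_eq ?_) h1
    rw [← Fin.card_Iic]
    congr 1
    ext r
    simp
  have hle : t' ≤ t := by
    by_contra! hlt
    have h1 := (hcard ⟨t, hlt⟩).trans (Finset.card_le_univ _)
    rw [Fintype.card_fin] at h1
    exact absurd h1 (by simp)
  refine ⟨hle, fun s => ?_⟩
  by_contra! hlt
  have h1 : (Finset.univ.filter fun r => f r ≤ g s) ⊆ Finset.Iio (Fin.castLE hle s) := by
    intro r hr
    rw [Finset.mem_Iio]
    exact f.lt_iff_lt.1 ((Finset.mem_filter.1 hr).2.trans_lt hlt)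
  have h2 := (hcard s).trans (Finset.card_le_card h1)
  rw [Fin.card_Iio] at h2
  exact absurd h2 (by simp)

namespace DeltaIdx

variable {m n : ℕ}

/-- The row set of an index pair. -/
def rows (P : DeltaIdx m n) : Finset (Fin m) := Finset.univ.map P.I.toEmbedding

/-- The column set of an index pair. -/
def cols (P : DeltaIdx m n) : Finset (Fin n) := Finset.univ.map P.J.toEmbedding

lemma card_rows (P : DeltaIdx m n) : P.rows.card = P.t := by simp [rows]

lemma le_of_isStdPair {P Q : DeltaIdx m n} (hI : IsStdPair P.rows Q.rows)
    (hJ : IsStdPair P.cols Q.cols) : P ≤ Q :=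
  let ⟨h, h1⟩ := exists_le_of_isStdPair hI
  ⟨h, h1, (exists_le_of_isStdPair hJ).2⟩

lemma ext_rows_cols {P Q : DeltaIdx m n} (hI : P.rows = Q.rows) (hJ : P.cols = Q.cols) : P = Q :=
  le_antisymm (le_of_isStdPair (hI ▸ fun _ => le_rfl) (hJ ▸ fun _ => le_rfl))
    (le_of_isStdPair (hI ▸ fun _ => le_rfl) (hJ ▸ fun _ => le_rfl))

/-- The index pair with given row and column sets. -/
def ofFinset (I : Finset (Fin m)) (J : Finset (Fin n)) (h : I.card = J.card) (h0 : I.Nonempty) :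
    DeltaIdx m n where
  t := I.card
  t_pos := h0.card_pos
  t_le := (Finset.card_le_univ I).trans_eq (Fintype.card_fin m)
  I := I.orderEmbOfFin rfl
  J := J.orderEmbOfFin h.symm

lemma exists_rows_cols {I : Finset (Fin m)} {J : Finset (Fin n)} (h : I.card = J.card)
    (h0 : I.Nonempty) : ∃ P : DeltaIdx m n, P.rows = I ∧ P.cols = J :=
  ⟨ofFinset I J h h0, (I.eq_map_orderEmbOfFin rfl).symm, (J.eq_map_orderEmbOfFin h.symm).symm⟩

/-- The lists of index pairs of length one or two which are nondecreasing and have the same content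
as `[a, b]`. -/
def StdTerms (a b : DeltaIdx m n) : Set (List (DeltaIdx m n)) :=
  {l | ∃ c, (l = [c] ∧ c.rows.val = a.rows.val + b.rows.val) ∨ ∃ d, c ≤ d ∧ l = [c, d] ∧
    c.rows.val + d.rows.val = a.rows.val + b.rows.val ∧
    c.cols.val + d.cols.val = a.cols.val + b.cols.val}

end DeltaIdx

section StandardMonomials

open DeltaIdx

variable {k : Type*} [Field k] {q : k} (hq : q ≠ 0) {m n : ℕ}

/-- The product of the quantum minors along a list of index pairs. -/
def qMonomial (l : List (DeltaIdx m n)) : QuantumMat k (Units.mk0 q hq) m n :=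
  (l.map fun P => qMinor k (Units.mk0 q hq) P).prod

lemma qMinor_mul_qMinor_mem_span (a b : DeltaIdx m n) :
    qMinor k (Units.mk0 q hq) a * qMinor k (Units.mk0 q hq) b ∈
      Submodule.span k (qMonomial hq '' StdTerms a b) := by
  rw [qMinor_eq_minor, qMinor_eq_minor]
  refine Submodule.span_mono ?_
    (minor_mul_minor_mem_span hq (qX_isQMatrix hq) a.rows b.rows a.cols b.cols)
  rintro x ⟨I, K, J, L, hIK, hJL, hIJ, hKL, hrow, hcol, rfl⟩
  have hI : I.Nonempty := by
    rw [Finset.nonempty_iff_ne_empty]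
    rintro rfl
    have hK : K = ∅ := by
      by_contra hK
      obtain ⟨x, hx⟩ := Finset.nonempty_iff_ne_empty.2 hK
      have h1 := hIK x
      rw [Finset.filter_empty, Finset.card_empty, Nat.le_zero, Finset.card_eq_zero,
        Finset.filter_eq_empty_iff] at h1
      exact h1 hx le_rfl
    subst hK
    have h1 := congrArg Multiset.card hrow
    simp only [Multiset.card_add, Finset.card_val, Finset.card_empty, card_rows] at h1
    have := a.t_pos
    omega
  obtain ⟨c, rfl, rfl⟩ := exists_rows_cols hIJ hI
  rcases K.eq_empty_or_nonempty with rfl | hK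
  · have hL : L = ∅ := Finset.card_eq_zero.1 hKL.symm
    subst hL
    refine ⟨[c], ⟨c, Or.inl ⟨rfl, by simpa using hrow⟩⟩, ?_⟩
    rw [minor_empty_left, if_pos rfl, mul_one]
    exact (List.prod_singleton).trans (qMinor_eq_minor hq c)
  · obtain ⟨d, rfl, rfl⟩ := exists_rows_cols hKL hK
    refine ⟨[c, d], ⟨c, Or.inr ⟨d, le_of_isStdPair hIK hJL, rfl, hrow, hcol⟩⟩, ?_⟩
    rw [qMonomial, List.map_cons, List.map_cons, List.map_nil, List.prod_cons, List.prod_singleton,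
      qMinor_eq_minor, qMinor_eq_minor]
    rfl

/-- The representation of the algebra of quantum matrices attached to an index pair. -/
noncomputable def qRep (hmn : m ≤ n) (P : DeltaIdx m n) : QuantumMat k (Units.mk0 q hq) m n →ₐ[k]
    Module.End k (((Bool × ℕ) × Fin (n + 1) →₀ ℤ) →₀ k) :=
  (repMatrix_isQMatrix hq hmn P).lift

lemma qRep_qMinor (hmn : m ≤ n) (P a : DeltaIdx m n) :
    qRep hq hmn P (qMinor k (Units.mk0 q hq) a) = minor q (repMatrix q hmn P)
      (Finset.univ.map a.I.toEmbedding) (Finset.univ.map a.J.toEmbedding) :=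
  IsQMatrix.lift_qMinor (B := Module.End k (((Bool × ℕ) × Fin (n + 1) →₀ ℤ) →₀ k))
    (repMatrix_isQMatrix hq hmn P) a

lemma qRep_qMinor_eq_zero (hmn : m ≤ n) {P a : DeltaIdx m n} (h : ¬ P ≤ a) :
    qRep hq hmn P (qMinor k (Units.mk0 q hq) a) = 0 :=
  (qRep_qMinor hq hmn P a).trans (repMatrix_minor_eq_zero hq hmn h)

lemma qRep_qMinor_hasLead (hmn : m ≤ n) {P a : DeltaIdx m n} (h : P ≤ a) :
    HasLead (towerWeight n) (minorExp hmn a) (qRep hq hmn P (qMinor k (Units.mk0 q hq) a)) := by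
  rw [qRep_qMinor]
  exact repMatrix_minor_hasLead hq hmn h

lemma qRep_qMonomial_eq_zero (hmn : m ≤ n) {P a : DeltaIdx m n} {l : List (DeltaIdx m n)}
    (ha : a ∈ l) (h : ¬ P ≤ a) : qRep hq hmn P (qMonomial hq l) = 0 := by
  rw [qMonomial, map_list_prod, List.map_map]
  exact List.prod_eq_zero (List.mem_map.2 ⟨a, ha, qRep_qMinor_eq_zero hq hmn h⟩)

lemma qRep_qMonomial_hasLead (hmn : m ≤ n) {P : DeltaIdx m n} {l : List (DeltaIdx m n)}
    (h : ∀ a ∈ l, P ≤ a) :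
    HasLead (towerWeight n) (l.map (minorExp hmn)).sum (qRep hq hmn P (qMonomial hq l)) := by
  rw [qMonomial, map_list_prod, List.map_map]
  exact HasLead.prod l fun a ha => qRep_qMinor_hasLead hq hmn (h a ha)

lemma eq_zero_of_qRep_sum_eq_zero (hmn : m ≤ n) (P : DeltaIdx m n)
    {s : Finset (List (DeltaIdx m n))} (hs : ∀ l ∈ s, l.IsChain (· ≤ ·) ∧ ∀ a ∈ l, P ≤ a)
    {c : List (DeltaIdx m n) → k} (h : qRep hq hmn P (∑ l ∈ s, c l • qMonomial hq l) = 0) :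
    ∀ l ∈ s, c l = 0 := by
  rw [map_sum] at h
  simp only [map_smul] at h
  exact eq_zero_of_sum_smul_hasLead
    (fun l hl l' hl' h => sum_minorExp_injective hmn (hs l hl).1 (hs l' hl').1 h)
    (fun l hl => qRep_qMonomial_hasLead hq hmn (hs l hl).2) h

/-- The least index pair. -/
def DeltaIdx.least (hm : 0 < m) (hmn : m ≤ n) : DeltaIdx m n where
  t := m
  t_pos := hm
  t_le := le_rfl
  I := RelEmbedding.refl _
  J := Fin.castLEOrderEmb hmn

lemma DeltaIdx.least_le (hmn : m ≤ n) (hm : 0 < m) (P : DeltaIdx m n) :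
    DeltaIdx.least hm hmn ≤ P := by
  have hval : ∀ {N : ℕ} (f : Fin P.t ↪o Fin N) (s : Fin P.t), (s : ℕ) ≤ f s := by
    intro N f s
    have h := Finset.card_le_card (Finset.map_subset_iff_subset_preimage.2 fun r hr =>
      Finset.mem_preimage.2 (Finset.mem_Iic.2 (f.monotone (Finset.mem_Iic.1 hr))) :
        (Finset.Iic s).map f.toEmbedding ⊆ Finset.Iic (f s))
    rw [Finset.card_map, Fin.card_Iic, Fin.card_Iic] at h
    omega
  exact ⟨P.t_le, fun s => hval P.I s, fun s => hval P.J s⟩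

lemma linearIndependent_qMonomial (hmn : m ≤ n) (hm : 0 < m) :
    LinearIndependent k
      fun l : {l : List (DeltaIdx m n) // l.IsChain (· ≤ ·)} => qMonomial (k := k) hq l.1 := by
  classical
  rw [linearIndependent_iff']
  intro s c h l hl
  have := eq_zero_of_qRep_sum_eq_zero hq hmn (DeltaIdx.least hm hmn)
    (s := s.map (Function.Embedding.subtype _))
    (c := fun l => if h : l.IsChain (· ≤ ·) then c ⟨l, h⟩ else 0)
    (fun l hl => ⟨Finset.property_of_mem_map_subtype s hl,
      fun a _ => DeltaIdx.least_le hmn hm a⟩)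
    (by
      rw [← map_zero (qRep hq hmn (DeltaIdx.least hm hmn)), ← h, Finset.sum_map]
      refine congrArg _ (Finset.sum_congr rfl fun l _ => ?_)
      exact congrArg (· • _) (dif_pos l.2))
    l (Finset.mem_map_of_mem _ hl)
  rwa [dif_pos l.2] at this

/-- Terms whose first factor does not survive in the representation attached to it may be
discarded. -/
lemma mem_span_of_qRep_eq_zero (hmn : m ≤ n) {C : Set (List (DeltaIdx m n))}
    (hC : ∀ l ∈ C, l.IsChain (· ≤ ·)) {z : QuantumMat k (Units.mk0 q hq) m n}
    (hz : z ∈ Submodule.span k (qMonomial hq '' C)) {p : DeltaIdx m n → Prop}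
    (hp : ∀ P, ¬ p P → qRep hq hmn P z = 0) :
    z ∈ Submodule.span k (qMonomial hq '' {l ∈ C | ∀ a ∈ l.head?, p a}) := by
  classical
  rw [Finsupp.mem_span_image_iff_linearCombination] at hz ⊢
  obtain ⟨c, hc, rfl⟩ := hz
  refine ⟨c, (Finsupp.mem_supported _ _).2 fun l hl =>
    ⟨(Finsupp.mem_supported _ _).1 hc hl, fun P hP => ?_⟩, rfl⟩
  by_contra hpP
  have h := hp P hpP
  rw [Finsupp.linearCombination_apply, Finsupp.sum, map_sum] at h
  refine Finsupp.mem_support_iff.1 hl (eq_zero_of_qRep_sum_eq_zero hq hmn P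
    (s := c.support.filter fun l => l.IsChain (· ≤ ·) ∧ ∀ a ∈ l, P ≤ a)
    (fun l hl => (Finset.mem_filter.1 hl).2) ?_ l ?_)
  · rw [← h, map_sum, Finset.sum_filter]
    refine Finset.sum_congr rfl fun l' hl' => ?_
    split_ifs with h'
    · rfl
    · have h2 : ∃ a ∈ l', ¬ P ≤ a := by
        by_contra! hcon
        exact h' ⟨hC _ ((Finsupp.mem_supported _ _).1 hc hl'), hcon⟩
      obtain ⟨a, ha, hPa⟩ := h2
      rw [map_smul, qRep_qMonomial_eq_zero hq hmn ha hPa, smul_zero]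
  · have hchain := hC _ ((Finsupp.mem_supported _ _).1 hc hl)
    refine Finset.mem_filter.2 ⟨hl, hchain, ?_⟩
    cases l with
    | nil => simp at hP
    | cons b l =>
      obtain rfl : b = P := by simpa using hP
      intro a ha
      rcases List.mem_cons.1 ha with rfl | ha
      · exact le_rfl
      · exact List.rel_of_pairwise_cons hchain.pairwise ha

lemma DeltaIdx.StdTerms.isChain {a b : DeltaIdx m n} {l : List (DeltaIdx m n)}
    (h : l ∈ StdTerms a b) : l.IsChain (· ≤ ·) := by
  obtain ⟨c, ⟨rfl, -⟩ | ⟨d, hcd, rfl, -⟩⟩ := h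
  · simp
  · simpa using hcd

/-- A product of two quantum minors only involves standard monomials whose first factor lies below
both factors. -/
lemma qMinor_mul_qMinor_mem_span_le (hmn : m ≤ n) (a b : DeltaIdx m n) :
    qMinor k (Units.mk0 q hq) a * qMinor k (Units.mk0 q hq) b ∈
      Submodule.span k (qMonomial hq '' {l ∈ StdTerms a b | ∀ c ∈ l.head?, c ≤ a ∧ c ≤ b}) := by
  refine mem_span_of_qRep_eq_zero hq hmn (fun l hl => StdTerms.isChain hl)
    (qMinor_mul_qMinor_mem_span hq a b) fun P hP => ?_
  rw [map_mul]
  rcases not_and_or.1 hP with h | h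
  · rw [qRep_qMinor_eq_zero hq hmn h, zero_mul]
  · rw [qRep_qMinor_eq_zero hq hmn h, mul_zero]

/-- The terms allowed on the right hand side of the straightening and commutation relations. -/
def lowerTerms (a b : DeltaIdx m n) : Set (QuantumMat k (Units.mk0 q hq) m n) :=
  {x | ∃ lam, lam < a ∧ lam < b ∧ (x = qMinor k (Units.mk0 q hq) lam ∨
    ∃ mu, lam ≤ mu ∧ x = qMinor k (Units.mk0 q hq) lam * qMinor k (Units.mk0 q hq) mu)}

lemma lowerTerms_comm (a b : DeltaIdx m n) :
    lowerTerms (k := k) hq a b = lowerTerms hq b a := by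
  ext x
  simp only [lowerTerms, Set.mem_ofPred_eq]
  exact exists_congr fun c => and_left_comm

lemma qMonomial_mem_lowerTerms {a b a' b' : DeltaIdx m n} {l : List (DeltaIdx m n)}
    (hl : l ∈ StdTerms a' b') (h : ∀ c ∈ l.head?, c < a ∧ c < b) :
    qMonomial hq l ∈ lowerTerms (k := k) hq a b := by
  obtain ⟨c, ⟨rfl, -⟩ | ⟨d, hcd, rfl, -⟩⟩ := hl
  · exact ⟨c, (h c rfl).1, (h c rfl).2, Or.inl (by simp [qMonomial])⟩
  · exact ⟨c, (h c rfl).1, (h c rfl).2, Or.inr ⟨d, hcd, by simp [qMonomial]⟩⟩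

lemma qMinor_mul_qMinor_straighten (hmn : m ≤ n) {a b : DeltaIdx m n} (hab : ¬ a ≤ b)
    (hba : ¬ b ≤ a) :
    qMinor k (Units.mk0 q hq) a * qMinor k (Units.mk0 q hq) b ∈
      Submodule.span k (lowerTerms hq a b) := by
  refine Submodule.span_mono ?_ (qMinor_mul_qMinor_mem_span_le hq hmn a b)
  rintro _ ⟨l, ⟨hl, h⟩, rfl⟩
  refine qMonomial_mem_lowerTerms hq hl fun c hc => ?_
  obtain ⟨h1, h2⟩ := h c hc
  exact ⟨lt_of_le_of_ne h1 (by rintro rfl; exact hab h2),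
    lt_of_le_of_ne h2 (by rintro rfl; exact hba h1)⟩

lemma qMinor_mul_qMinor_of_le (hmn : m ≤ n) {a b : DeltaIdx m n} (hab : a ≤ b) :
    ∃ c : k, c ≠ 0 ∧ qMinor k (Units.mk0 q hq) b * qMinor k (Units.mk0 q hq) a -
      c • (qMinor k (Units.mk0 q hq) a * qMinor k (Units.mk0 q hq) b) ∈
        Submodule.span k (lowerTerms hq a b) := by
  have hmem : qMinor k (Units.mk0 q hq) b * qMinor k (Units.mk0 q hq) a ∈ Submodule.span k
      (insert (qMinor k (Units.mk0 q hq) a * qMinor k (Units.mk0 q hq) b)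
        (lowerTerms hq a b)) := by
    refine Submodule.span_mono ?_ (qMinor_mul_qMinor_mem_span_le hq hmn b a)
    rintro _ ⟨l, ⟨hl, h⟩, rfl⟩
    by_cases hhead : a ∈ l.head?
    · left
      obtain ⟨c, ⟨rfl, hc⟩ | ⟨d, hcd, rfl, hr, hc⟩⟩ := hl
      · obtain rfl : c = a := by simpa using hhead
        have h1 := congrArg Multiset.card hc
        rw [Multiset.card_add, Finset.card_val, Finset.card_val, card_rows, card_rows] at h1
        have := b.t_pos
        omega
      · obtain rfl : c = a := by simpa using hhead
        rw [add_comm, add_left_inj] at hr hc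
        obtain rfl : d = b := ext_rows_cols (Finset.val_injective hr) (Finset.val_injective hc)
        simp [qMonomial]
    · right
      refine qMonomial_mem_lowerTerms hq hl fun c hc => ?_
      have h1 : c < a := lt_of_le_of_ne (h c hc).2 (by rintro rfl; exact hhead hc)
      exact ⟨h1, h1.trans_le hab⟩
  obtain ⟨c, s, hs, hcs⟩ := Submodule.mem_span_insert.1 hmem
  refine ⟨c, ?_, ?_⟩
  · rintro rfl
    rw [zero_smul, zero_add] at hcs
    have hs0 : qRep hq hmn a s = 0 := by
      clear hcs
      induction hs using Submodule.span_induction with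
      | mem x hx =>
        obtain ⟨d, hd, -, rfl | ⟨e, -, rfl⟩⟩ := hx
        · exact qRep_qMinor_eq_zero hq hmn hd.not_ge
        · rw [map_mul, qRep_qMinor_eq_zero hq hmn hd.not_ge, zero_mul]
      | zero => exact map_zero _
      | add x y _ _ hx hy => rw [map_add, hx, hy, add_zero]
      | smul c x _ hx => rw [map_smul, hx, smul_zero]
    have hlead := (qRep_qMinor_hasLead hq hmn hab).mul (qRep_qMinor_hasLead hq hmn (le_refl a))
    rw [← map_mul, hcs, hs0] at hlead
    exact hlead.ne_zero rfl
  · rwa [hcs, add_sub_cancel_left]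

lemma qMinor_comm (hmn : m ≤ n) (a b : DeltaIdx m n) :
    ∃ c : k, c ≠ 0 ∧ qMinor k (Units.mk0 q hq) a * qMinor k (Units.mk0 q hq) b -
      c • (qMinor k (Units.mk0 q hq) b * qMinor k (Units.mk0 q hq) a) ∈
        Submodule.span k (lowerTerms hq a b) := by
  by_cases hba : b ≤ a
  · rw [lowerTerms_comm]
    exact qMinor_mul_qMinor_of_le hq hmn hba
  by_cases hab : a ≤ b
  · obtain ⟨c, hc, h⟩ := qMinor_mul_qMinor_of_le hq hmn hab
    refine ⟨c⁻¹, inv_ne_zero hc, ?_⟩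
    have h1 := Submodule.smul_mem _ (-c⁻¹) h
    rwa [smul_sub, smul_smul, neg_mul, inv_mul_cancel₀ hc, neg_smul, neg_smul, one_smul,
      sub_neg_eq_add, neg_add_eq_sub] at h1
  · refine ⟨1, one_ne_zero, Submodule.sub_mem _ (qMinor_mul_qMinor_straighten hq hmn hab hba)
      (Submodule.smul_mem _ _ ?_)⟩
    rw [lowerTerms_comm]
    exact qMinor_mul_qMinor_straighten hq hmn hba hab

end StandardMonomials

/-- Let `k` be a field, `m ≤ n` positive integers and `q ∈ k` nonzero.
Then `O_q(M_{m,n}(k))` — with its ℕ-grading in which every generator `X i j` is homogeneous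
of degree `1` — is a quantum graded algebra with a straightening law on the poset
`(Δ_{m,n}, ≤st)` of all quantum minors. -/
theorem quantumMatrices_isQASL (k : Type*) [Field k] (q : k) (hq : q ≠ 0)
    (m n : ℕ) (hm : 0 < m) (hmn : m ≤ n) :
    ∃ (𝒜 : ℕ → Submodule k (QuantumMat k (Units.mk0 q hq) m n))
      (Q : QuantumGradedASL k (QuantumMat k (Units.mk0 q hq) m n) 𝒜 (DeltaIdx m n)),
      (∀ P : DeltaIdx m n, Q.elem P = qMinor k (Units.mk0 q hq) P) ∧
      (∀ (i : Fin m) (j : Fin n), qX k (Units.mk0 q hq) i j ∈ 𝒜 1) :=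
  ⟨fun d => qXSpan k hq m n ^ d,
    { elem := fun P => qMinor k (Units.mk0 q hq) P
      graded := quantumMatGradedAlgebra hq
      homog := fun P => ⟨P.t, P.t_pos, qMinor_mem_pow hq P⟩
      gen := adjoin_range_qMinor hq hm
      indep := linearIndependent_qMonomial hq hmn hm
      straighten := fun _ _ => qMinor_mul_qMinor_straighten hq hmn
      comm := qMinor_comm hq hmn },
    fun _ => rfl, fun i j => by simpa only [pow_one] using qX_mem_qXSpan hq i j⟩
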